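/- Suppose exactly one boundary condition is λ-dependent, S = {i}, and let the eigenvalues be listed as the strictly increasing sequence λ₀ < λ₁ < λ₂ < ⋯ with corresponding real-valued eigen-solutions φ_n. Then the number of zeros of φ_n in the open interval (z₁,z₂) is as follows. (i) If the problem is right-definite (D_i > 0) and d_i ≠ 0: φ_n has exactly n zeros in (z₁,z₂) when λ_n < −b_i/d_i, and exactly n−1 zeros when λ_n ≥ −b_i/d_i. (ii) If the problem is right-definite and d_i = 0: φ_n has exactly n zeros in (z₁,z₂). (iii) If the problem is left-definite with D_i < 0 and 0 is not an eigenvalue: the eigenvalues satisfy λ₀ < 0 < λ₁ < λ₂ < ⋯; both φ₀ and φ₁ have no zeros in (z₁,z₂), and for every n > 1 the eigen-solution φ_n has exactly n−1 zeros in (z₁,z₂). -/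

import Mathlib

open MeasureTheory Filter Topology

noncomputable section

/-- Data of a Sturm–Liouville problem with (possibly) eigenvalue-dependent
boundary conditions on `[z1, z2]`. -/
structure SLP where
  z1 : ℝ
  z2 : ℝ
  hz : z1 < z2
  p : ℝ → ℝ
  q : ℝ → ℝ
  r : ℝ → ℝ
  a : Fin 2 → ℝ
  b : Fin 2 → ℝ
  c : Fin 2 → ℝ
  d : Fin 2 → ℝ
  hp : ContDiff ℝ 2 p
  hr : ContDiff ℝ 2 r
  hq : Continuous q
  hppos : ∀ z ∈ Set.Icc z1 z2, 0 < p z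
  hrpos : ∀ z ∈ Set.Icc z1 z2, 0 < r z
  hab : ∀ j : Fin 2, (a j, b j) ≠ (0, 0)

namespace SLP

variable (P : SLP)

/-- The two boundary points: `zb 0 = z1`, `zb 1 = z2`. -/
def zb : Fin 2 → ℝ := ![P.z1, P.z2]

/-- The sign `(−1)^{j+1}` (for the boundary labelled `j+1`, here `j : Fin 2`). -/
def sgn (_P : SLP) (j : Fin 2) : ℝ := (-1 : ℝ) ^ (j : ℕ)

/-- `j ∈ S`: the boundary condition at `zb j` is λ-dependent. -/
def inS (j : Fin 2) : Prop := (P.c j, P.d j) ≠ (0, 0)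

instance (j : Fin 2) : Decidable (P.inS j) := by unfold inS; infer_instance

/-- The set `S` of λ-dependent boundaries, as a finset. -/
def Sfin : Finset (Fin 2) := Finset.univ.filter fun j => P.inS j

/-- The boundary parameter `D_j = (−1)^{j+1}(a_j d_j − b_j c_j)`. -/
def D (j : Fin 2) : ℝ := P.sgn j * (P.a j * P.d j - P.b j * P.c j)

/-- `B_j φ = a_j φ(z_j) − b_j p(z_j) φ′(z_j)`. -/
def Bop (j : Fin 2) (φ : ℝ → ℂ) : ℂ :=
  (P.a j : ℂ) * φ (P.zb j) - (P.b j : ℂ) * ((P.p (P.zb j) : ℂ) * deriv φ (P.zb j))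

/-- `C_j φ = c_j φ(z_j) − d_j p(z_j) φ′(z_j)`. -/
def Cop (j : Fin 2) (φ : ℝ → ℂ) : ℂ :=
  (P.c j : ℂ) * φ (P.zb j) - (P.d j : ℂ) * ((P.p (P.zb j) : ℂ) * deriv φ (P.zb j))

/-- The function `Φ` associated to `φ`: equal to `φ` away from λ-dependent
boundary points, and equal to `C_j φ` at `zb j` for `j ∈ S`. -/
def assoc (φ : ℝ → ℂ) : ℝ → ℂ := fun z =>
  if P.inS 0 ∧ z = P.zb 0 then P.Cop 0 φ
  else if P.inS 1 ∧ z = P.zb 1 then P.Cop 1 φ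
  else φ z

/-- The (possibly indefinite) inner product
`⟨F,G⟩ = ∫ conj(F) G r dz + Σ_{j∈S} D_j⁻¹ conj(F(z_j)) G(z_j)`. -/
def inp (F G : ℝ → ℂ) : ℂ :=
  (∫ z in P.z1..P.z2, (starRingEnd ℂ) (F z) * G z * (P.r z : ℂ)) +
    ∑ j ∈ P.Sfin, ((P.D j : ℂ))⁻¹ * (starRingEnd ℂ) (F (P.zb j)) * G (P.zb j)

/-- `(λ, φ)` is an eigenpair of the problem. -/
def IsEigenpair (lam : ℂ) (φ : ℝ → ℂ) : Prop :=
  ContDiff ℝ 2 φ ∧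
  (∃ z ∈ Set.Icc P.z1 P.z2, φ z ≠ 0) ∧
  (∀ z ∈ Set.Ioo P.z1 P.z2,
    -(deriv (fun w => (P.p w : ℂ) * deriv φ w) z) + (P.q z : ℂ) * φ z
      = lam * ((P.r z : ℂ) * φ z)) ∧
  (∀ j : Fin 2, -(P.Bop j φ) = lam * P.Cop j φ)

/-- `λ` is an eigenvalue of the problem. -/
def IsEigenvalue (lam : ℂ) : Prop := ∃ φ, P.IsEigenpair lam φ

/-- Right-definiteness: `D_j > 0` for every `j ∈ S` (together with `r > 0`,
which is part of the standing assumptions). -/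
def RightDefinite : Prop := ∀ j : Fin 2, P.inS j → 0 < P.D j

/-- Left-definiteness sign conditions. -/
def LeftDefinite : Prop :=
  (∀ z ∈ Set.Icc P.z1 P.z2, 0 ≤ P.q z) ∧
  (∀ j : Fin 2, P.inS j →
    P.a j * P.c j / P.D j ≤ 0 ∧ P.b j * P.d j / P.D j ≤ 0 ∧
      0 ≤ (-P.sgn j) * (P.a j * P.d j) / P.D j) ∧
  (∀ j : Fin 2, ¬ P.inS j → P.b j = 0 ∨ 0 ≤ P.sgn j * P.a j / P.b j)

/-- The measure `μ = r(z) dz + Σ_{j∈S} D_j⁻¹ δ_{z_j}` on `[z1,z2]`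
(right-definite case, where `D_j > 0`). -/
def muM : Measure ℝ :=
  (volume.restrict (Set.Icc P.z1 P.z2)).withDensity (fun z => ENNReal.ofReal (P.r z)) +
    ∑ j ∈ P.Sfin, (ENNReal.ofReal (P.D j)⁻¹) • Measure.dirac (P.zb j)

/-- The positive measure `μ̃ = r(z) dz + Σ_{j∈S} |D_j|⁻¹ δ_{z_j}` on `[z1,z2]`. -/
def muAbs : Measure ℝ :=
  (volume.restrict (Set.Icc P.z1 P.z2)).withDensity (fun z => ENNReal.ofReal (P.r z)) +
    ∑ j ∈ P.Sfin, (ENNReal.ofReal |P.D j|⁻¹) • Measure.dirac (P.zb j)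

/-- The weighted interior measure `r(z) dz` on `[z1,z2]`. -/
def muInt : Measure ℝ :=
  (volume.restrict (Set.Icc P.z1 P.z2)).withDensity (fun z => ENNReal.ofReal (P.r z))

end SLP

namespace Prufer

open Real Set

theorem exists_integrating_factor {x y : ℝ} (hxy : x ≤ y) {h : ℝ → ℝ}
    (hh : ContinuousOn h (Icc x y)) :
    ∃ E : ℝ → ℝ, Continuous E ∧ (∀ t, 0 < E t) ∧
      ∀ t ∈ Icc x y, HasDerivWithinAt E (-(h t) * E t) (Icc x y) t := by
  have hc : Continuous (IccExtend hxy ((Icc x y).domRestrict h)) :=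
    continuous_IccExtend_iff.2 (continuousOn_iff_continuous_domRestrict.1 hh)
  have hd : ∀ t, HasDerivAt (fun t => exp (-∫ s in x..t, IccExtend hxy ((Icc x y).domRestrict h) s))
      (exp (-∫ s in x..t, IccExtend hxy ((Icc x y).domRestrict h) s) *
        -(IccExtend hxy ((Icc x y).domRestrict h) t)) t := fun t =>
    ((hc.integral_hasStrictDerivAt x t).hasDerivAt.neg).exp
  refine ⟨_, continuous_iff_continuousAt.2 fun t => (hd t).continuousAt, fun t => exp_pos _, ?_⟩
  intro t ht
  have := hd t
  rw [IccExtend_of_mem hxy _ ht] at this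
  simpa [domRestrict_apply, mul_comm] using this.hasDerivWithinAt

section Linear

variable {x y : ℝ} {w h g : ℝ → ℝ}

theorem exists_weight_hasDerivAt (hxy : x ≤ y) (hh : ContinuousOn h (Icc x y))
    (hw' : ∀ t ∈ Ioo x y, HasDerivAt w (h t * w t + g t) t) :
    ∃ E : ℝ → ℝ, Continuous E ∧ (∀ t, 0 < E t) ∧
      ∀ t ∈ Ioo x y, HasDerivAt (fun t => w t * E t) (g t * E t) t := by
  obtain ⟨E, hE, hpos, hd⟩ := exists_integrating_factor hxy hh
  refine ⟨E, hE, hpos, fun t ht => ?_⟩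
  convert! (hw' t ht).mul
    ((hd t (Ioo_subset_Icc_self ht)).hasDerivAt (Icc_mem_nhds ht.1 ht.2)) using 1
  ring

theorem nonneg_of_linear (hw : ContinuousOn w (Icc x y)) (hh : ContinuousOn h (Icc x y))
    (hw' : ∀ t ∈ Ioo x y, HasDerivAt w (h t * w t + g t) t) (hg : ∀ t ∈ Ioo x y, 0 ≤ g t)
    {s t : ℝ} (hs : s ∈ Icc x y) (ht : t ∈ Icc x y) (hst : s ≤ t) (h0 : 0 ≤ w s) : 0 ≤ w t := by
  obtain ⟨E, hE, hpos, hd⟩ := exists_weight_hasDerivAt (hs.1.trans hs.2) hh hw'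
  have hm : MonotoneOn (fun t => w t * E t) (Icc x y) := by
    refine monotoneOn_of_hasDerivWithinAt_nonneg (convex_Icc x y) (hw.mul hE.continuousOn)
      (f' := fun t => g t * E t) ?_ ?_ <;> rw [interior_Icc]
    · exact fun u hu => (hd u hu).hasDerivWithinAt
    · exact fun u hu => mul_nonneg (hg u hu) (hpos u).le
  have h1 := hm hs ht hst
  exact nonneg_of_mul_nonneg_left ((mul_nonneg h0 (hpos s).le).trans h1) (hpos t)

theorem pos_of_linear (hw : ContinuousOn w (Icc x y)) (hh : ContinuousOn h (Icc x y))
    (hw' : ∀ t ∈ Ioo x y, HasDerivAt w (h t * w t + g t) t) (hg : ∀ t ∈ Ioo x y, 0 < g t)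
    {s t : ℝ} (hs : s ∈ Icc x y) (ht : t ∈ Icc x y) (hst : s < t) (h0 : 0 ≤ w s) : 0 < w t := by
  obtain ⟨E, hE, hpos, hd⟩ := exists_weight_hasDerivAt (hs.1.trans hs.2) hh hw'
  have hm : StrictMonoOn (fun t => w t * E t) (Icc x y) := by
    refine strictMonoOn_of_hasDerivWithinAt_pos (convex_Icc x y) (hw.mul hE.continuousOn)
      (f' := fun t => g t * E t) ?_ ?_ <;> rw [interior_Icc]
    · exact fun u hu => (hd u hu).hasDerivWithinAt
    · exact fun u hu => mul_pos (hg u hu) (hpos u)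
  have h1 := hm hs ht hst
  exact pos_of_mul_pos_left ((mul_nonneg h0 (hpos s).le).trans_lt h1) (hpos t).le

theorem eq_zero_of_linear (hw : ContinuousOn w (Icc x y)) (hh : ContinuousOn h (Icc x y))
    (hw' : ∀ t ∈ Ioo x y, HasDerivAt w (h t * w t) t)
    {s t : ℝ} (hs : s ∈ Icc x y) (ht : t ∈ Icc x y) (h0 : w s = 0) : w t = 0 := by
  obtain ⟨E, hE, hpos, hd⟩ := exists_weight_hasDerivAt (g := fun _ => 0) (hs.1.trans hs.2) hh
    (fun t ht => by simpa using hw' t ht)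
  have hd' : ∀ u ∈ interior (Icc x y),
      HasDerivWithinAt (fun t => w t * E t) (0 * E u) (interior (Icc x y)) u := by
    rw [interior_Icc]; exact fun u hu => (hd u hu).hasDerivWithinAt
  have h1 := monotoneOn_of_hasDerivWithinAt_nonneg (convex_Icc x y) (hw.mul hE.continuousOn) hd'
    (by simp)
  have h2 := antitoneOn_of_hasDerivWithinAt_nonpos (convex_Icc x y) (hw.mul hE.continuousOn) hd'
    (by simp)
  have h3 : w t * E t = w s * E s := by
    rcases le_total s t with hst | hst
    · exact le_antisymm (h2 hs ht hst) (h1 hs ht hst)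
    · exact le_antisymm (h1 ht hs hst) (h2 ht hs hst)
  rw [h0, zero_mul] at h3
  exact (mul_eq_zero.1 h3).resolve_right (hpos t).ne'

end Linear

theorem sinc_mul_self (x : ℝ) : sinc x * x = sin x := by
  rcases eq_or_ne x 0 with rfl | hx
  · simp
  · rw [sinc_of_ne_zero hx, div_mul_cancel₀ _ hx]

/-- `θ` solves the Prüfer equation `θ' = A cos² θ + B sin² θ` on `[x, y]`. -/
def IsAngle (A B : ℝ → ℝ) (x y : ℝ) (θ : ℝ → ℝ) : Prop :=
  ∀ t ∈ Icc x y, HasDerivWithinAt θ (A t * cos (θ t) ^ 2 + B t * sin (θ t) ^ 2) (Icc x y) t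

theorem sin_sq_sub_sin_sq (a b : ℝ) : sin a ^ 2 - sin b ^ 2 = sin (a - b) * sin (a + b) := by
  rw [sin_sub, sin_add]
  have h1 := sin_sq_add_cos_sq a
  have h2 := sin_sq_add_cos_sq b
  linear_combination (sin b ^ 2) * h1 - (sin a ^ 2) * h2

theorem lipschitzWith_rhs {a b K : ℝ} (hK : |b - a| ≤ K) :
    LipschitzWith K.toNNReal (fun u : ℝ => a * cos u ^ 2 + b * sin u ^ 2) := by
  refine LipschitzWith.of_dist_le_mul fun u v => ?_
  rw [Real.coe_toNNReal _ ((abs_nonneg _).trans hK), Real.dist_eq, Real.dist_eq]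
  have : a * cos u ^ 2 + b * sin u ^ 2 - (a * cos v ^ 2 + b * sin v ^ 2) =
      (b - a) * (sin (u - v) * sin (u + v)) := by
    rw [← sin_sq_sub_sin_sq, cos_sq', cos_sq']; ring
  rw [this, abs_mul, abs_mul]
  calc |b - a| * (|sin (u - v)| * |sin (u + v)|) ≤ K * (|u - v| * 1) := by
        exact mul_le_mul hK (mul_le_mul abs_sin_le_abs (abs_sin_le_one _) (abs_nonneg _)
          (abs_nonneg _)) (by positivity) ((abs_nonneg _).trans hK)
    _ = K * |u - v| := by ring

theorem abs_rhs_le (a b u : ℝ) : |a * cos u ^ 2 + b * sin u ^ 2| ≤ |a| + |b| := by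
  refine (abs_add_le _ _).trans (add_le_add ?_ ?_)
  · rw [abs_mul, abs_of_nonneg (sq_nonneg (cos u))]
    exact mul_le_of_le_one_right (abs_nonneg _) (cos_sq_le_one u)
  · rw [abs_mul, abs_of_nonneg (sq_nonneg (sin u))]
    exact mul_le_of_le_one_right (abs_nonneg _) (sin_sq_le_one u)

section Angle

variable {x y : ℝ} {A B θ : ℝ → ℝ}

theorem exists_isAngle (hxy : x < y) (hA : ContinuousOn A (Icc x y))
    (hB : ContinuousOn B (Icc x y)) (α : ℝ) : ∃ θ, IsAngle A B x y θ ∧ θ x = α := by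
  obtain ⟨M, hM⟩ := isCompact_Icc.exists_bound_of_continuousOn hA
  obtain ⟨N, hN⟩ := isCompact_Icc.exists_bound_of_continuousOn hB
  have hx : x ∈ Icc x y := left_mem_Icc.2 hxy.le
  have hM0 : 0 ≤ M := (norm_nonneg _).trans (hM x hx)
  have hN0 : 0 ≤ N := (norm_nonneg _).trans (hN x hx)
  have hpl : IsPicardLindelof (fun t u => A t * cos u ^ 2 + B t * sin u ^ 2)
      (⟨x, hx⟩ : Icc x y) α ((M + N) * (y - x)).toNNReal 0 (M + N).toNNReal (N + M).toNNReal := by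
    refine ⟨fun t ht => (lipschitzWith_rhs ?_).lipschitzOnWith, fun u _ => ?_,
      fun t ht u _ => ?_, ?_⟩
    · exact (abs_sub _ _).trans (add_le_add (hN t ht) (hM t ht))
    · exact (hA.mul continuousOn_const).add (hB.mul continuousOn_const)
    · rw [Real.coe_toNNReal _ (add_nonneg hM0 hN0)]
      exact (abs_rhs_le _ _ _).trans (add_le_add (hM t ht) (hN t ht))
    · rw [Real.coe_toNNReal _ (add_nonneg hM0 hN0),
        Real.coe_toNNReal _ (mul_nonneg (add_nonneg hM0 hN0) (sub_nonneg.2 hxy.le))]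
      simp [hxy.le]
  obtain ⟨θ, h0, h1⟩ := hpl.exists_eq_forall_mem_Icc_hasDerivWithinAt₀
  exact ⟨θ, h1, h0⟩

namespace IsAngle

theorem continuousOn (h : IsAngle A B x y θ) : ContinuousOn θ (Icc x y) :=
  fun t ht => (h t ht).continuousWithinAt

theorem hasDerivAt (h : IsAngle A B x y θ) {t : ℝ} (ht : t ∈ Ioo x y) :
    HasDerivAt θ (A t * cos (θ t) ^ 2 + B t * sin (θ t) ^ 2) t :=
  (h t (Ioo_subset_Icc_self ht)).hasDerivAt (Icc_mem_nhds ht.1 ht.2)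

theorem hasDerivWithinAt_Ici (h : IsAngle A B x y θ) {t : ℝ} (ht : t ∈ Ico x y) :
    HasDerivWithinAt θ (A t * cos (θ t) ^ 2 + B t * sin (θ t) ^ 2) (Ici t) t :=
  (h t (Ico_subset_Icc_self ht)).mono_of_mem_nhdsWithin
    (Icc_mem_nhdsGE_of_mem ht)

end IsAngle

end Angle
end Prufer

namespace Prufer
open Real Set

namespace IsAngle

variable {x y : ℝ} {A B A' B' θ θ' : ℝ → ℝ}

theorem le_of_le (h : IsAngle A B x y θ) (h' : IsAngle A' B' x y θ')
    (hA' : ContinuousOn A' (Icc x y)) (hB' : ContinuousOn B' (Icc x y))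
    (hAA : ∀ t ∈ Icc x y, A t ≤ A' t) (hBB : ∀ t ∈ Icc x y, B t ≤ B' t) (h0 : θ x ≤ θ' x)
    {t : ℝ} (ht : t ∈ Icc x y) : θ t ≤ θ' t := by
  have hθ := h.continuousOn
  have hθ' := h'.continuousOn
  have := nonneg_of_linear (w := fun t => θ' t - θ t)
    (h := fun t => (B' t - A' t) * (sinc (θ' t - θ t) * sin (θ' t + θ t)))
    (g := fun t => (A' t - A t) * cos (θ t) ^ 2 + (B' t - B t) * sin (θ t) ^ 2)
    (hθ'.sub hθ)
    ((hB'.sub hA').mul ((continuous_sinc.comp_continuousOn (hθ'.sub hθ)).mul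
      (continuous_sin.comp_continuousOn (hθ'.add hθ)))) ?_ ?_
    (left_mem_Icc.2 (ht.1.trans ht.2)) ht ht.1 (sub_nonneg.2 h0)
  · exact sub_nonneg.1 this
  · intro t ht
    convert! (h'.hasDerivAt ht).sub (h.hasDerivAt ht) using 1
    have e := sin_sq_sub_sin_sq (θ' t) (θ t)
    rw [← sinc_mul_self (θ' t - θ t)] at e
    rw [cos_sq', cos_sq']
    linear_combination (-(B' t - A' t)) * e
  · intro t ht
    have ht := Ioo_subset_Icc_self ht
    exact add_nonneg (mul_nonneg (sub_nonneg.2 (hAA t ht)) (sq_nonneg _))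
      (mul_nonneg (sub_nonneg.2 (hBB t ht)) (sq_nonneg _))

theorem int_mul_pi_lt (h : IsAngle A B x y θ)
    (hA : ContinuousOn A (Icc x y)) (hB : ContinuousOn B (Icc x y))
    (hpos : ∀ t ∈ Icc x y, 0 < A t) (k : ℤ) {s t : ℝ} (hs : s ∈ Icc x y) (ht : t ∈ Icc x y)
    (hst : s < t) (h0 : k * π ≤ θ s) : k * π < θ t := by
  have hθ := h.continuousOn
  have hc : ContinuousOn (fun t => θ t - k * π) (Icc x y) := hθ.sub continuousOn_const
  have := pos_of_linear (w := fun t => θ t - k * π)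
    (h := fun t => (B t - A t) * (sinc (θ t - k * π) * sin (θ t - k * π)))
    (g := A) hc
    ((hB.sub hA).mul ((continuous_sinc.comp_continuousOn hc).mul
      (continuous_sin.comp_continuousOn hc))) ?_ (fun t ht => hpos t (Ioo_subset_Icc_self ht))
    hs ht hst (sub_nonneg.2 h0)
  · exact sub_pos.1 this
  · intro t ht
    convert! (h.hasDerivAt ht).sub_const (k * π) using 1
    have e := sinc_mul_self (θ t - k * π)
    have e2 : sin (θ t - k * π) ^ 2 = sin (θ t) ^ 2 := by
      rcases Int.even_or_odd k with hk | hk <;> simp [sin_sub_int_mul_pi, hk.neg_one_zpow]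
    rw [cos_sq']
    linear_combination ((B t - A t) * sin (θ t - k * π)) * e + (B t - A t) * e2

theorem pi_div_two_sub_hasDerivAt (h : IsAngle A B x y θ) {t : ℝ} (ht : t ∈ Ioo x y) :
    HasDerivAt (fun t => π / 2 - θ t)
      ((B t - A t) * (sinc (π / 2 - θ t) * sin (π / 2 - θ t)) * (π / 2 - θ t) + -B t) t := by
  convert! (h.hasDerivAt ht).const_sub (π / 2) using 1
  have e := sinc_mul_self (π / 2 - θ t)
  rw [sin_pi_div_two_sub] at e ⊢
  rw [sin_sq]
  linear_combination ((B t - A t) * cos (θ t)) * e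

theorem le_pi_div_two (h : IsAngle A B x y θ)
    (hA : ContinuousOn A (Icc x y)) (hB : ContinuousOn B (Icc x y))
    (hneg : ∀ t ∈ Icc x y, B t ≤ 0) (h0 : θ x ≤ π / 2) {t : ℝ} (ht : t ∈ Icc x y) :
    θ t ≤ π / 2 := by
  have hc : ContinuousOn (fun t => π / 2 - θ t) (Icc x y) := continuousOn_const.sub h.continuousOn
  exact sub_nonneg.1 (nonneg_of_linear hc
    ((hB.sub hA).mul ((continuous_sinc.comp_continuousOn hc).mul
      (continuous_sin.comp_continuousOn hc))) (fun t ht => h.pi_div_two_sub_hasDerivAt ht)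
    (fun t ht => neg_nonneg.2 (hneg t (Ioo_subset_Icc_self ht)))
    (left_mem_Icc.2 (ht.1.trans ht.2)) ht ht.1 (sub_nonneg.2 h0))

theorem lt_pi_div_two (h : IsAngle A B x y θ)
    (hA : ContinuousOn A (Icc x y)) (hB : ContinuousOn B (Icc x y))
    (hneg : ∀ t ∈ Icc x y, B t < 0) (h0 : θ x ≤ π / 2) {t : ℝ} (ht : t ∈ Ioc x y) :
    θ t < π / 2 := by
  have hc : ContinuousOn (fun t => π / 2 - θ t) (Icc x y) := continuousOn_const.sub h.continuousOn
  exact sub_pos.1 (pos_of_linear hc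
    ((hB.sub hA).mul ((continuous_sinc.comp_continuousOn hc).mul
      (continuous_sin.comp_continuousOn hc))) (fun t ht => h.pi_div_two_sub_hasDerivAt ht)
    (fun t ht => neg_pos.2 (hneg t (Ioo_subset_Icc_self ht)))
    (left_mem_Icc.2 (ht.1.le.trans ht.2)) (Ioc_subset_Icc_self ht) ht.1 (sub_nonneg.2 h0))

theorem dist_le (h : IsAngle A B x y θ) (h' : IsAngle A' B' x y θ') {K δ ε : ℝ}
    (hK : ∀ t ∈ Icc x y, |B t - A t| ≤ K) (hδ : dist (θ' x) (θ x) ≤ δ)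
    (hε : ∀ t ∈ Icc x y, |A' t - A t| + |B' t - B t| ≤ ε) {t : ℝ} (ht : t ∈ Icc x y) :
    dist (θ' t) (θ t) ≤ gronwallBound δ K ε (t - x) := by
  have hK0 : 0 ≤ K := (abs_nonneg _).trans (hK t ht)
  have := dist_le_of_approx_trajectories_ODE_of_mem (a := x) (b := y) (s := fun _ => univ)
    (v := fun t u => A t * cos u ^ 2 + B t * sin u ^ 2) (K := K.toNNReal) (εf := ε) (εg := 0)
    (fun t ht => (lipschitzWith_rhs (hK t (Ico_subset_Icc_self ht))).lipschitzOnWith)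
    h'.continuousOn (fun t ht => h'.hasDerivWithinAt_Ici ht) ?_ (fun _ _ => mem_univ _)
    h.continuousOn (fun t ht => h.hasDerivWithinAt_Ici ht) ?_ (fun _ _ => mem_univ _) hδ t ht
  · rwa [Real.coe_toNNReal _ hK0, add_zero] at this
  · intro t ht
    rw [Real.dist_eq]
    refine le_trans (le_of_eq ?_)
      ((abs_rhs_le (A' t - A t) (B' t - B t) (θ' t)).trans (hε t (Ico_subset_Icc_self ht)))
    congr 1
    ring
  · intro t ht
    simp

theorem ncard_zeros (h : IsAngle A B x y θ)
    (hA : ContinuousOn A (Icc x y)) (hB : ContinuousOn B (Icc x y))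
    (hpos : ∀ t ∈ Icc x y, 0 < A t) (hxy : x < y) (h0 : 0 ≤ θ x) (h1 : θ x < π) {n : ℕ}
    (hn : n * π < θ y) (hn' : θ y ≤ (n + 1) * π) :
    {t ∈ Ioo x y | sin (θ t) = 0}.ncard = n := by
  have hx : x ∈ Icc x y := left_mem_Icc.2 hxy.le
  have hy : y ∈ Icc x y := right_mem_Icc.2 hxy.le
  have hex : ∀ i, i < n → ∃ t ∈ Ioo x y, θ t = (i + 1) * π := by
    intro i hi
    have hi' : ((i : ℝ) + 1) ≤ n := by exact_mod_cast hi
    have hm : ((i : ℝ) + 1) * π ∈ Ioo (θ x) (θ y) := by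
      refine ⟨?_, lt_of_le_of_lt ?_ hn⟩
      · have : (0 : ℝ) ≤ i * π := by positivity
        linarith
      · gcongr
    exact intermediate_value_Ioo hxy.le h.continuousOn hm
  choose f hf hfθ using hex
  refine ncard_eq_of_bijective f ?_ ?_ ?_
  · rintro t ⟨ht, hst⟩
    obtain ⟨k, hk⟩ := sin_eq_zero_iff.1 hst
    have ht' := Ioo_subset_Icc_self ht
    have hk0 : 0 < k := by
      have := h.int_mul_pi_lt hA hB hpos 0 hx ht' ht.1 (by simpa using h0)
      rw [← hk, Int.cast_zero, zero_mul] at this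
      exact_mod_cast pos_of_mul_pos_left this pi_pos.le
    have hkn : k < n + 1 := by
      have := (h.int_mul_pi_lt hA hB hpos k ht' hy ht.2 hk.le).trans_le hn'
      exact_mod_cast lt_of_mul_lt_mul_right this pi_pos.le
    obtain ⟨j, rfl⟩ : ∃ j : ℕ, k = j + 1 := ⟨(k - 1).toNat, by omega⟩
    have hj : j < n := by omega
    refine ⟨j, hj, ?_⟩
    have e : θ (f j hj) = θ t := by rw [hfθ, ← hk]; push_cast; ring
    have hfm := Ioo_subset_Icc_self (hf j hj)
    rcases lt_trichotomy (f j hj) t with hlt | heq | hlt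
    · have := h.int_mul_pi_lt hA hB hpos _ hfm ht' hlt (hk.trans e.symm).le
      exact absurd this (by rw [hk]; exact lt_irrefl _)
    · exact heq
    · have := h.int_mul_pi_lt hA hB hpos _ ht' hfm hlt hk.le
      exact absurd this (by rw [hk, e]; exact lt_irrefl _)
  · intro i hi
    refine ⟨hf i hi, ?_⟩
    rw [hfθ]
    exact_mod_cast sin_nat_mul_pi (i + 1)
  · intro i j hi hj hij
    have := hfθ i hi
    rw [hij, hfθ j hj] at this
    have := mul_right_cancel₀ pi_pos.ne' this
    exact_mod_cast (add_right_cancel this).symm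

/-- Where `B` is very negative, the angle ends close to `0`. -/
theorem le_of_barrier (h : IsAngle A B x y θ) (hxy : x < y) {ε a : ℝ}
    (hε : 0 < ε) (hε' : ε ≤ π / 2) (h0 : θ x ≤ π - ε)
    (hA : ∀ t ∈ Icc x y, A t ≤ a) (ha : 0 ≤ a)
    (hB : ∀ t ∈ Icc x y, B t * sin ε ^ 2 + a < -(π / (y - x))) : θ y ≤ ε := by
  have hyx : 0 < y - x := sub_pos.2 hxy
  have hs : 0 < sin ε := sin_pos_of_pos_of_lt_pi hε (by linarith [pi_pos])
  have key := image_le_of_deriv_right_lt_deriv_boundary (f := θ) (a := x) (b := y)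
    (B := fun t => (π - ε) + (t - x) * (-(π - 2 * ε) / (y - x)))
    (B' := fun _ => -(π - 2 * ε) / (y - x)) h.continuousOn
    (fun t ht => h.hasDerivWithinAt_Ici ht) (by simpa using h0) ?_ ?_ (right_mem_Icc.2 hxy.le)
  · refine key.trans (le_of_eq ?_)
    field_simp
    ring
  · intro t
    simpa using ((hasDerivAt_id t).sub_const x).mul_const (-(π - 2 * ε) / (y - x))
      |>.const_add (π - ε)
  · intro t ht hθt
    have ht' := Ico_subset_Icc_self ht
    have htx : 0 ≤ t - x := sub_nonneg.2 ht.1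
    have hq0 : 0 ≤ (t - x) / (y - x) := div_nonneg htx hyx.le
    have hq1 : (t - x) / (y - x) ≤ 1 := (div_le_one hyx).2 (by linarith [ht.2])
    have e : (t - x) * (-(π - 2 * ε) / (y - x)) = -((t - x) / (y - x) * (π - 2 * ε)) := by ring
    have h1 : ε ≤ θ t := by
      rw [hθt, e]; nlinarith
    have h2 : θ t ≤ π - ε := by
      rw [hθt, e]; nlinarith
    have h3 : sin ε ≤ sin (θ t) := by
      rcases le_total (θ t) (π / 2) with h4 | h4
      · exact sin_le_sin_of_le_of_le_pi_div_two (by linarith [pi_pos]) h4 h1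
      · rw [← sin_pi_sub (θ t)]
        exact sin_le_sin_of_le_of_le_pi_div_two (by linarith [pi_pos]) (by linarith) (by linarith)
    have h4 : sin ε ^ 2 ≤ sin (θ t) ^ 2 := pow_le_pow_left₀ hs.le h3 2
    have h5 := hB t ht'
    have h6 : 0 < π / (y - x) := div_pos pi_pos hyx
    have h7 : B t ≤ 0 := by nlinarith [pow_pos hs 2]
    have h8 : A t * cos (θ t) ^ 2 ≤ a := by
      nlinarith [hA t ht', cos_sq_le_one (θ t), sq_nonneg (cos (θ t))]
    have h9 : B t * sin (θ t) ^ 2 ≤ B t * sin ε ^ 2 := mul_le_mul_of_nonpos_left h4 h7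
    have h10 : -(π / (y - x)) ≤ -(π - 2 * ε) / (y - x) := by
      rw [← neg_div]
      gcongr
      linarith
    linarith

/-- Where `A` is very large, the angle reaches a neighbourhood of `π / 2`. -/
theorem le_of_barrier' (h : IsAngle A B x y θ) (hxy : x < y) {ε b : ℝ}
    (hε : 0 < ε) (hε' : ε ≤ π / 2) (h0 : 0 ≤ θ x)
    (hB : ∀ t ∈ Icc x y, -b ≤ B t) (hb : 0 ≤ b)
    (hA : ∀ t ∈ Icc x y, π / (y - x) < A t * sin ε ^ 2 - b) : π / 2 - ε ≤ θ y := by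
  have hyx : 0 < y - x := sub_pos.2 hxy
  have hs : 0 < sin ε := sin_pos_of_pos_of_lt_pi hε (by linarith [pi_pos])
  have key := image_le_of_deriv_right_lt_deriv_boundary (f := fun t => -θ t) (a := x) (b := y)
    (B := fun t => (t - x) * (-(π / 2 - ε) / (y - x)))
    (B' := fun _ => -(π / 2 - ε) / (y - x)) h.continuousOn.neg
    (fun t ht => (h.hasDerivWithinAt_Ici ht).neg) (by simpa using h0) ?_ ?_
    (right_mem_Icc.2 hxy.le)
  · have e : (y - x) * (-(π / 2 - ε) / (y - x)) = -(π / 2 - ε) := by field_simp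
    simp only [e] at key
    linarith
  · intro t
    simpa using ((hasDerivAt_id t).sub_const x).mul_const (-(π / 2 - ε) / (y - x))
  · intro t ht hθt
    have ht' := Ico_subset_Icc_self ht
    have htx : 0 ≤ t - x := sub_nonneg.2 ht.1
    have hq0 : 0 ≤ (t - x) / (y - x) := div_nonneg htx hyx.le
    have hq1 : (t - x) / (y - x) ≤ 1 := (div_le_one hyx).2 (by linarith [ht.2])
    have e : (t - x) * (-(π / 2 - ε) / (y - x)) = -((t - x) / (y - x) * (π / 2 - ε)) := by ring
    rw [e, neg_inj] at hθt
    have h1 : 0 ≤ θ t := by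
      rw [hθt]; exact mul_nonneg hq0 (by linarith)
    have h2 : θ t ≤ π / 2 - ε := by
      rw [hθt]; nlinarith
    have h3 : sin ε ≤ cos (θ t) := by
      rw [← cos_pi_div_two_sub]
      exact cos_le_cos_of_nonneg_of_le_pi h1 (by linarith [pi_pos]) h2
    have h4 : sin ε ^ 2 ≤ cos (θ t) ^ 2 := pow_le_pow_left₀ hs.le h3 2
    have h5 := hA t ht'
    have h6 : 0 < π / (y - x) := div_pos pi_pos hyx
    have h7 : 0 ≤ A t := by nlinarith [pow_pos hs 2]
    have h8 : -b ≤ B t * sin (θ t) ^ 2 := by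
      nlinarith [hB t ht', sin_sq_le_one (θ t), sq_nonneg (sin (θ t))]
    have h9 : A t * sin ε ^ 2 ≤ A t * cos (θ t) ^ 2 := mul_le_mul_of_nonneg_left h4 h7
    have h10 : -(π / (y - x)) ≤ -(π / 2 - ε) / (y - x) := by
      rw [← neg_div]
      gcongr
      linarith [pi_pos]
    linarith

/-- Every solution of `v' = A u`, `u' = -B v` with the initial direction of `θ` has polar angle
`θ` throughout. -/
theorem exists_radius (h : IsAngle A B x y θ)
    (hA : ContinuousOn A (Icc x y)) (hB : ContinuousOn B (Icc x y)) {v u : ℝ → ℝ}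
    (hv : ContinuousOn v (Icc x y)) (hu : ContinuousOn u (Icc x y))
    (hv' : ∀ t ∈ Ioo x y, HasDerivAt v (A t * u t) t)
    (hu' : ∀ t ∈ Ioo x y, HasDerivAt u (-(B t * v t)) t)
    (h0 : v x * cos (θ x) = u x * sin (θ x)) :
    ∃ ρ : ℝ → ℝ, (∀ t ∈ Icc x y, v t = ρ t * sin (θ t) ∧ u t = ρ t * cos (θ t)) ∧
      ((∃ t ∈ Icc x y, v t ≠ 0) → ∀ t ∈ Icc x y, ρ t ≠ 0) := by
  have hθ := h.continuousOn
  have hs : ContinuousOn (fun t => sin (θ t)) (Icc x y) := continuous_sin.comp_continuousOn hθ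
  have hc : ContinuousOn (fun t => cos (θ t)) (Icc x y) := continuous_cos.comp_continuousOn hθ
  have hk : ∀ t ∈ Icc x y, v t * cos (θ t) - u t * sin (θ t) = 0 := by
    intro t ht
    refine eq_zero_of_linear (w := fun t => v t * cos (θ t) - u t * sin (θ t))
      (h := fun t => -((A t - B t) * (sin (θ t) * cos (θ t))))
      ((hv.mul hc).sub (hu.mul hs)) ((hA.sub hB).mul (hs.mul hc)).neg ?_
      (left_mem_Icc.2 (ht.1.trans ht.2)) ht (sub_eq_zero.2 h0)
    intro t ht
    have hd := h.hasDerivAt ht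
    convert! ((hv' t ht).mul hd.cos).sub ((hu' t ht).mul hd.sin) using 1
    have e := sin_sq_add_cos_sq (θ t)
    linear_combination (A t * u t * cos (θ t) + B t * v t * sin (θ t)) * e
  refine ⟨fun t => v t * sin (θ t) + u t * cos (θ t), fun t ht => ?_, ?_⟩
  · have e := sin_sq_add_cos_sq (θ t)
    constructor
    · linear_combination (-v t) * e + cos (θ t) * hk t ht
    · linear_combination (-u t) * e - sin (θ t) * hk t ht
  · rintro ⟨s, hs', hvs⟩ t ht h00
    have : v s * sin (θ s) + u s * cos (θ s) = 0 := by
      refine eq_zero_of_linear (w := fun t => v t * sin (θ t) + u t * cos (θ t))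
        (h := fun t => (A t - B t) * (sin (θ t) * cos (θ t)))
        ((hv.mul hs).add (hu.mul hc)) ((hA.sub hB).mul (hs.mul hc)) ?_ ht hs' h00
      intro t ht
      have hd := h.hasDerivAt ht
      convert! ((hv' t ht).mul hd.sin).add ((hu' t ht).mul hd.cos) using 1
      have e := sin_sq_add_cos_sq (θ t)
      have hk' := hk t (Ioo_subset_Icc_self ht)
      linear_combination (A t * u t * sin (θ t) - B t * v t * cos (θ t)) * e
        + (A t * sin (θ t) ^ 2 + B t * cos (θ t) ^ 2
          - (A t * cos (θ t) ^ 2 + B t * sin (θ t) ^ 2)) * hk'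
    apply hvs
    have e := sin_sq_add_cos_sq (θ s)
    linear_combination (-v s) * e + cos (θ s) * hk s hs' + sin (θ s) * this

/-- A Prüfer angle comes from a solution of `v' = A u`, `u' = -B v`. -/
theorem exists_solution (h : IsAngle A B x y θ) (hxy : x ≤ y)
    (hA : ContinuousOn A (Icc x y)) (hB : ContinuousOn B (Icc x y)) :
    ∃ ρ : ℝ → ℝ, (∀ t, 0 < ρ t) ∧
      (∀ t ∈ Icc x y, HasDerivWithinAt (fun t => ρ t * sin (θ t))
        (A t * (ρ t * cos (θ t))) (Icc x y) t) ∧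
      (∀ t ∈ Icc x y, HasDerivWithinAt (fun t => ρ t * cos (θ t))
        (-(B t * (ρ t * sin (θ t)))) (Icc x y) t) := by
  have hθ := h.continuousOn
  have hc : ContinuousOn (fun t => -((A t - B t) * (sin (θ t) * cos (θ t)))) (Icc x y) :=
    ((hA.sub hB).mul ((continuous_sin.comp_continuousOn hθ).mul
      (continuous_cos.comp_continuousOn hθ))).neg
  obtain ⟨ρ, -, hpos, hd⟩ := exists_integrating_factor hxy hc
  refine ⟨ρ, hpos, fun t ht => ?_, fun t ht => ?_⟩
  · convert! (hd t ht).mul (h t ht).sin using 1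
    have e := sin_sq_add_cos_sq (θ t)
    linear_combination (-(A t * ρ t * cos (θ t))) * e
  · convert! (hd t ht).mul (h t ht).cos using 1
    have e := sin_sq_add_cos_sq (θ t)
    linear_combination (B t * ρ t * sin (θ t)) * e

end IsAngle
end Prufer

namespace Prufer
open Real Set

theorem exists_contDiff_extension {x y : ℝ} (hxy : x ≤ y) {v v' v'' : ℝ → ℝ}
    (hv : ∀ t ∈ Icc x y, HasDerivWithinAt v (v' t) (Icc x y) t)
    (hv' : ∀ t ∈ Icc x y, HasDerivWithinAt v' (v'' t) (Icc x y) t)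
    (hv'' : ContinuousOn v'' (Icc x y)) :
    ∃ V : ℝ → ℝ, ContDiff ℝ 2 V ∧ ∀ t ∈ Icc x y, V t = v t ∧ deriv V t = v' t := by
  have hx : x ∈ Icc x y := left_mem_Icc.2 hxy
  have hc : Continuous (IccExtend hxy ((Icc x y).domRestrict v'')) :=
    continuous_IccExtend_iff.2 (continuousOn_iff_continuous_domRestrict.1 hv'')
  set k := IccExtend hxy ((Icc x y).domRestrict v'') with hk
  have hkv : ∀ t ∈ Icc x y, k t = v'' t := fun t ht => by
    rw [hk, IccExtend_of_mem hxy _ ht, domRestrict_apply]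
  set V' : ℝ → ℝ := fun t => v' x + ∫ s in x..t, k s with hV'
  have hV'd : ∀ t, HasDerivAt V' (k t) t := fun t =>
    (hc.integral_hasStrictDerivAt x t).hasDerivAt.const_add (v' x)
  have hV'c : Continuous V' := continuous_iff_continuousAt.2 fun t => (hV'd t).continuousAt
  set V : ℝ → ℝ := fun t => v x + ∫ s in x..t, V' s with hV
  have hVd : ∀ t, HasDerivAt V (V' t) t := fun t =>
    (hV'c.integral_hasStrictDerivAt x t).hasDerivAt.const_add (v x)
  have hVd' : deriv V = V' := funext fun t => (hVd t).deriv
  have hVd'' : deriv V' = k := funext fun t => (hV'd t).deriv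
  have hIco : ∀ {f : ℝ → ℝ} {f' t : ℝ}, t ∈ Ico x y → HasDerivWithinAt f f' (Icc x y) t →
      HasDerivWithinAt f f' (Ici t) t := fun ht h =>
    h.mono_of_mem_nhdsWithin (Icc_mem_nhdsGE_of_mem ht)
  have e1 : ∀ t ∈ Icc x y, V' t = v' t :=
    eq_of_has_deriv_right_eq (f' := k) (fun t _ => (hV'd t).hasDerivWithinAt)
      (fun t ht => by
        rw [hkv t (Ico_subset_Icc_self ht)]
        exact hIco ht (hv' t (Ico_subset_Icc_self ht)))
      hV'c.continuousOn (fun t ht => (hv' t ht).continuousWithinAt) (by simp [hV'])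
  have e2 : ∀ t ∈ Icc x y, V t = v t :=
    eq_of_has_deriv_right_eq (f' := V') (fun t _ => (hVd t).hasDerivWithinAt)
      (fun t ht => by
        rw [e1 t (Ico_subset_Icc_self ht)]
        exact hIco ht (hv t (Ico_subset_Icc_self ht)))
      (fun t _ => (hVd t).continuousAt.continuousWithinAt)
      (fun t ht => (hv t ht).continuousWithinAt) (by simp [hV])
  refine ⟨V, ?_, fun t ht => ⟨e2 t ht, by rw [hVd', e1 t ht]⟩⟩
  rw [show (2 : WithTop ℕ∞) = 1 + 1 from rfl, contDiff_succ_iff_deriv, hVd',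
    contDiff_one_iff_deriv, hVd'']
  exact ⟨fun t => (hVd t).differentiableAt, by simp, fun t => (hV'd t).differentiableAt, hc⟩

end Prufer

namespace SLP
open Real Set

variable {P : SLP} {κ l : ℝ} {v : ℝ → ℝ}

/-- `(l, v)` is an eigenpair with `l` and `v` real. -/
structure IsRealPair (P : SLP) (l : ℝ) (v : ℝ → ℝ) : Prop where
  contDiff : ContDiff ℝ 2 v
  exists_ne : ∃ z ∈ Icc P.z1 P.z2, v z ≠ 0
  hasDerivAt : ∀ z ∈ Ioo P.z1 P.z2,
    HasDerivAt (fun w => P.p w * deriv v w) ((P.q z - l * P.r z) * v z) z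
  boundary : ∀ j, (P.a j + l * P.c j) * v (P.zb j) =
    (P.b j + l * P.d j) * (P.p (P.zb j) * deriv v (P.zb j))

theorem isEigenpair_ofReal_iff :
    P.IsEigenpair (l : ℂ) (fun z => (v z : ℂ)) ↔ P.IsRealPair l v := by
  by_cases hv : ContDiff ℝ 2 v
  swap
  · refine ⟨fun h => (hv ?_).elim, fun h => (hv h.1).elim⟩
    exact Complex.reCLM.contDiff.comp h.1
  have hv1 : Differentiable ℝ v := hv.differentiable (by simp)
  have hv2 : Differentiable ℝ (deriv v) := by
    have : ContDiff ℝ (1 + 1) v := hv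
    exact (contDiff_succ_iff_deriv.1 this).2.2.differentiable (by simp)
  have hp : Differentiable ℝ P.p := P.hp.differentiable (by simp)
  have hd : deriv (fun z => (v z : ℂ)) = fun z => ((deriv v z : ℝ) : ℂ) :=
    funext fun z => ((hv1 z).hasDerivAt.ofReal_comp).deriv
  have hpd : ∀ z, HasDerivAt (fun w => P.p w * deriv v w)
      (deriv (fun w => P.p w * deriv v w) z) z := fun z => ((hp z).mul (hv2 z)).hasDerivAt
  have hdd : ∀ z, deriv (fun w => (P.p w : ℂ) * ((deriv v w : ℝ) : ℂ)) z
      = ((deriv (fun w => P.p w * deriv v w) z : ℝ) : ℂ) := fun z => by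
    have := ((hpd z).ofReal_comp).deriv
    simpa using this
  have key : ∀ z, (-(deriv (fun w => (P.p w : ℂ) * deriv (fun z => (v z : ℂ)) w) z)
      + (P.q z : ℂ) * v z = l * ((P.r z : ℂ) * v z)) ↔
      HasDerivAt (fun w => P.p w * deriv v w) ((P.q z - l * P.r z) * v z) z := by
    intro z
    rw [hd, hdd]
    norm_cast
    constructor
    · intro h
      convert! hpd z using 1
      linarith
    · intro h
      rw [h.deriv]
      ring
  have keyb : ∀ j, -(P.Bop j (fun z => (v z : ℂ))) = l * P.Cop j (fun z => (v z : ℂ)) ↔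
      (P.a j + l * P.c j) * v (P.zb j) =
        (P.b j + l * P.d j) * (P.p (P.zb j) * deriv v (P.zb j)) := by
    intro j
    unfold Bop Cop
    rw [hd]
    beta_reduce
    norm_cast
    constructor <;> intro h <;> linarith
  constructor
  · rintro ⟨-, h1, h2, h3⟩
    refine ⟨hv, ?_, fun z hz => (key z).1 (h2 z hz), fun j => (keyb j).1 (h3 j)⟩
    simpa using h1
  · rintro ⟨-, h1, h2, h3⟩
    refine ⟨Complex.ofRealCLM.contDiff.comp hv, ?_, fun z hz => (key z).2 (h2 z hz),
      fun j => (keyb j).2 (h3 j)⟩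
    simpa using h1

/-- The initial value of the `κ`-scaled Prüfer angle prescribed by the boundary condition
`a 0 * v = b 0 * p * v'`. -/
def initialAngle (P : SLP) (κ : ℝ) : ℝ :=
  if P.b 0 = 0 then 0 else π / 2 - arctan (P.a 0 / (κ * P.b 0))

theorem initialAngle_nonneg : 0 ≤ P.initialAngle κ := by
  unfold initialAngle
  split_ifs
  · exact le_rfl
  · linarith [arctan_lt_pi_div_two (P.a 0 / (κ * P.b 0))]

theorem initialAngle_lt_pi : P.initialAngle κ < π := by
  unfold initialAngle
  split_ifs
  · exact pi_pos
  · linarith [neg_pi_div_two_lt_arctan (P.a 0 / (κ * P.b 0))]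

theorem initialAngle_spec (hκ : κ ≠ 0) :
    P.a 0 * sin (P.initialAngle κ) = P.b 0 * (κ * cos (P.initialAngle κ)) := by
  unfold initialAngle
  split_ifs with h
  · simp [h]
  · rw [sin_pi_div_two_sub, cos_pi_div_two_sub, ← tan_mul_cos (cos_arctan_pos _).ne', tan_arctan]
    field_simp

theorem initialAngle_direction (hκ : κ ≠ 0) {x u : ℝ} (h : P.a 0 * x = P.b 0 * (κ * u)) :
    x * cos (P.initialAngle κ) = u * sin (P.initialAngle κ) := by
  by_cases hb : P.b 0 = 0
  · have ha : P.a 0 ≠ 0 := fun ha => P.hab 0 (by simp [ha, hb])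
    have : x = 0 := by simpa [hb, ha] using h
    simp [initialAngle, hb, this]
  · have hs := P.initialAngle_spec hκ
    refine mul_left_cancel₀ (mul_ne_zero hb hκ) ?_
    linear_combination sin (P.initialAngle κ) * h - x * hs

/-- The coefficients of the equation of the `κ`-scaled Prüfer angle: with `u = p v' / κ`,
the differential equation reads `v' = A u`, `u' = -B v`. -/
def coeffA (P : SLP) (κ z : ℝ) : ℝ := κ / P.p z

/-- The coefficient of `sin θ ^ 2` in the Prüfer equation. -/
def coeffB (P : SLP) (κ l z : ℝ) : ℝ := (l * P.r z - P.q z) / κ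

theorem continuousOn_coeffA : ContinuousOn (P.coeffA κ) (Icc P.z1 P.z2) :=
  continuousOn_const.div P.hp.continuous.continuousOn fun z hz => (P.hppos z hz).ne'

theorem continuousOn_coeffB : ContinuousOn (P.coeffB κ l) (Icc P.z1 P.z2) :=
  (((continuous_const.mul P.hr.continuous).sub P.hq).div_const κ).continuousOn

theorem coeffA_pos (hκ : 0 < κ) {z : ℝ} (hz : z ∈ Icc P.z1 P.z2) : 0 < P.coeffA κ z :=
  div_pos hκ (P.hppos z hz)

/-- The `κ`-scaled Prüfer angle with spectral parameter `l`. -/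
def prufer (P : SLP) (κ l : ℝ) : ℝ → ℝ :=
  (Prufer.exists_isAngle P.hz (P.continuousOn_coeffA (κ := κ))
    (P.continuousOn_coeffB (κ := κ) (l := l)) (P.initialAngle κ)).choose

theorem isAngle_prufer :
    Prufer.IsAngle (P.coeffA κ) (P.coeffB κ l) P.z1 P.z2 (P.prufer κ l) :=
  (Prufer.exists_isAngle P.hz (P.continuousOn_coeffA (κ := κ))
    (P.continuousOn_coeffB (κ := κ) (l := l)) (P.initialAngle κ)).choose_spec.1

theorem prufer_left : P.prufer κ l P.z1 = P.initialAngle κ :=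
  (Prufer.exists_isAngle P.hz (P.continuousOn_coeffA (κ := κ))
    (P.continuousOn_coeffB (κ := κ) (l := l)) (P.initialAngle κ)).choose_spec.2

theorem prufer_pos (hκ : 0 < κ) {t : ℝ} (ht : t ∈ Ioc P.z1 P.z2) : 0 < P.prufer κ l t := by
  have := isAngle_prufer.int_mul_pi_lt (P.continuousOn_coeffA (κ := κ))
    (P.continuousOn_coeffB (κ := κ) (l := l)) (fun z hz => P.coeffA_pos hκ hz) 0
    (left_mem_Icc.2 P.hz.le) (Ioc_subset_Icc_self ht) ht.1
    (by rw [prufer_left]; simpa using P.initialAngle_nonneg)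
  simpa using this

/-- Polar coordinates of an eigen-solution, in the situation where the boundary condition at the
left end does not depend on the eigenvalue. -/
theorem IsRealPair.exists_radius (h : P.IsRealPair l v) (hκ : κ ≠ 0) (hc : P.c 0 = 0)
    (hd : P.d 0 = 0) :
    ∃ ρ : ℝ → ℝ, ∀ t ∈ Icc P.z1 P.z2, ρ t ≠ 0 ∧ v t = ρ t * sin (P.prufer κ l t) ∧
      P.p t * deriv v t = κ * (ρ t * cos (P.prufer κ l t)) := by
  have hv1 : Differentiable ℝ v := h.contDiff.differentiable (by simp)
  have hv2 : Continuous (deriv v) := h.contDiff.continuous_deriv (by simp)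
  obtain ⟨ρ, hρ, hρ0⟩ := isAngle_prufer.exists_radius (P.continuousOn_coeffA (κ := κ))
    (P.continuousOn_coeffB (κ := κ) (l := l)) (v := v) (u := fun t => P.p t * deriv v t / κ)
    hv1.continuous.continuousOn
    ((P.hp.continuous.mul hv2).div_const κ).continuousOn
    (fun t ht => by
      have hp := (P.hppos t (Ioo_subset_Icc_self ht)).ne'
      convert! (hv1 t).hasDerivAt using 1
      unfold coeffA
      field_simp)
    (fun t ht => by
      convert! (h.hasDerivAt t ht).div_const κ using 1
      unfold coeffB
      ring)
    (by
      rw [prufer_left]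
      refine P.initialAngle_direction hκ ?_
      have := h.boundary 0
      simp only [hc, hd, zb, Matrix.cons_val_zero, mul_zero, add_zero] at this
      rw [this, mul_div_cancel₀ _ hκ])
  refine ⟨ρ, fun t ht => ⟨hρ0 h.exists_ne t ht, (hρ t ht).1, ?_⟩⟩
  rw [← (hρ t ht).2, mul_div_cancel₀ _ hκ]

theorem IsRealPair.zeros_eq (h : P.IsRealPair l v) (hκ : κ ≠ 0) (hc : P.c 0 = 0)
    (hd : P.d 0 = 0) :
    {z ∈ Ioo P.z1 P.z2 | v z = 0} = {z ∈ Ioo P.z1 P.z2 | sin (P.prufer κ l z) = 0} := by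
  obtain ⟨ρ, hρ⟩ := h.exists_radius hκ hc hd
  ext z
  refine and_congr_right fun hz => ?_
  obtain ⟨h0, h1, -⟩ := hρ z (Ioo_subset_Icc_self hz)
  rw [h1, mul_eq_zero, or_iff_right h0]

theorem exists_isRealPair_iff (hκ : κ ≠ 0) (hc : P.c 0 = 0) (hd : P.d 0 = 0) :
    (∃ v, P.IsRealPair l v) ↔ (P.a 1 + l * P.c 1) * sin (P.prufer κ l P.z2) =
      (P.b 1 + l * P.d 1) * (κ * cos (P.prufer κ l P.z2)) := by
  constructor
  · rintro ⟨v, h⟩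
    obtain ⟨ρ, hρ⟩ := h.exists_radius hκ hc hd
    obtain ⟨h0, h1, h2⟩ := hρ P.z2 (right_mem_Icc.2 P.hz.le)
    have := h.boundary 1
    simp only [zb, Matrix.cons_val_one, Matrix.cons_val_fin_one] at this
    rw [h1, h2] at this
    refine mul_left_cancel₀ h0 ?_
    linarith
  · intro h
    obtain ⟨ρ, hpos, h1, h2⟩ := isAngle_prufer.exists_solution P.hz.le
      (P.continuousOn_coeffA (κ := κ)) (P.continuousOn_coeffB (κ := κ) (l := l))
    have hx : P.z1 ∈ Icc P.z1 P.z2 := left_mem_Icc.2 P.hz.le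
    have hy : P.z2 ∈ Icc P.z1 P.z2 := right_mem_Icc.2 P.hz.le
    have hp : Differentiable ℝ P.p := P.hp.differentiable (by simp)
    have hp' : Continuous (deriv P.p) := P.hp.continuous_deriv (by simp)
    have hp0 : ∀ t ∈ Icc P.z1 P.z2, P.p t ≠ 0 := fun t ht => (P.hppos t ht).ne'
    set V := fun t => ρ t * sin (P.prufer κ l t) with hV
    set U := fun t => ρ t * cos (P.prufer κ l t) with hU
    have hVc : ContinuousOn V (Icc P.z1 P.z2) := fun t ht => (h1 t ht).continuousWithinAt
    have hUc : ContinuousOn U (Icc P.z1 P.z2) := fun t ht => (h2 t ht).continuousWithinAt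
    have hd' : ∀ t ∈ Icc P.z1 P.z2, HasDerivWithinAt (fun t => κ / P.p t * U t)
        ((0 * P.p t - κ * deriv P.p t) / P.p t ^ 2 * U t
          + κ / P.p t * -(P.coeffB κ l t * V t)) (Icc P.z1 P.z2) t := fun t ht =>
      (((hasDerivAt_const t κ).div (hp t).hasDerivAt (hp0 t ht)).hasDerivWithinAt).mul (h2 t ht)
    obtain ⟨w, hw, hw'⟩ := Prufer.exists_contDiff_extension P.hz.le h1 hd' (by
      refine ContinuousOn.add (ContinuousOn.mul (ContinuousOn.div ?_ ?_ ?_) hUc)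
        (ContinuousOn.mul (P.continuousOn_coeffA (κ := κ)) (P.continuousOn_coeffB.mul hVc).neg)
      · exact ((continuous_const.mul P.hp.continuous).sub
          (continuous_const.mul hp')).continuousOn
      · exact (P.hp.continuous.pow 2).continuousOn
      · exact fun t ht => pow_ne_zero 2 (hp0 t ht))
    have hpw : ∀ t ∈ Icc P.z1 P.z2, P.p t * deriv w t = κ * U t := fun t ht => by
      have := hp0 t ht
      rw [(hw' t ht).2, coeffA, hU]
      field_simp
    refine ⟨w, hw, ?_, fun z hz => ?_, fun j => ?_⟩
    · by_contra! h0
      have hs : ∀ t ∈ Icc P.z1 P.z2, sin (P.prufer κ l t) = 0 := fun t ht => by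
        have := (hw' t ht).1 ▸ h0 t ht
        simpa [hV, (hpos t).ne'] using this
      have hd0 : ∀ t ∈ Ioo P.z1 P.z2, deriv w t = 0 := fun t ht => by
        have : w =ᶠ[𝓝 t] fun _ => 0 := by
          filter_upwards [isOpen_Ioo.mem_nhds ht] with s hs'
          exact h0 s (Ioo_subset_Icc_self hs')
        rw [this.deriv_eq, deriv_const]
      obtain ⟨t, ht⟩ := nonempty_Ioo.2 P.hz
      have ht' := Ioo_subset_Icc_self ht
      have e1 := hpw t ht'
      rw [hd0 t ht, mul_zero] at e1
      have e2 : cos (P.prufer κ l t) = 0 := by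
        simpa [hU, hκ, (hpos t).ne'] using e1.symm
      have := sin_sq_add_cos_sq (P.prufer κ l t)
      rw [hs t ht', e2] at this
      norm_num at this
    · have hz' := Ioo_subset_Icc_self hz
      have hn := Icc_mem_nhds hz.1 hz.2
      have h3 : HasDerivAt (fun t => κ * U t) (κ * -(P.coeffB κ l z * V z)) z :=
        ((h2 z hz').hasDerivAt hn).const_mul κ
      have h4 : (fun t => P.p t * deriv w t) =ᶠ[𝓝 z] fun t => κ * U t := by
        filter_upwards [hn] with t ht using hpw t ht
      convert! h3.congr_of_eventuallyEq h4 using 1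
      rw [(hw' z hz').1, coeffB]
      field_simp
      ring
    · fin_cases j
      · have e := P.initialAngle_spec hκ
        simp only [Fin.zero_eta, hc, hd, zb, Matrix.cons_val_zero, mul_zero, add_zero]
        rw [hpw _ hx, (hw' _ hx).1]
        simp only [hV, hU, prufer_left]
        linear_combination ρ P.z1 * e
      · simp only [Fin.mk_one, zb, Matrix.cons_val_one, Matrix.cons_val_fin_one]
        rw [hpw _ hy, (hw' _ hy).1]
        simp only [hV, hU]
        linear_combination ρ P.z2 * h

end SLP

namespace SLP
open Real Set

variable {P : SLP} {κ l : ℝ} {v : ℝ → ℝ}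

theorem continuousAt_initialAngle (hκ : 0 < κ) : ContinuousAt P.initialAngle κ := by
  unfold initialAngle
  split_ifs with h
  · exact continuousAt_const
  · exact continuousAt_const.sub (continuous_arctan.continuousAt.comp
      (continuousAt_const.div (continuousAt_id.mul continuousAt_const)
        (mul_ne_zero hκ.ne' h)))

theorem continuousOn_prufer_right :
    ContinuousOn (fun x : ℝ × ℝ => P.prufer x.1 x.2 P.z2) {x | 0 < x.1} := by
  rintro ⟨κ, l⟩ (hκ : 0 < κ)
  refine ContinuousAt.continuousWithinAt ?_
  obtain ⟨K, hK⟩ := isCompact_Icc.exists_bound_of_continuousOn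
    ((P.continuousOn_coeffB (κ := κ) (l := l)).sub (P.continuousOn_coeffA (κ := κ)))
  obtain ⟨C1, hC1⟩ := isCompact_Icc.exists_bound_of_continuousOn (P.continuousOn_coeffA (κ := 1))
  obtain ⟨C2, hC2⟩ := isCompact_Icc.exists_bound_of_continuousOn
    (P.hr.continuous.continuousOn (s := Icc P.z1 P.z2))
  obtain ⟨C3, hC3⟩ := isCompact_Icc.exists_bound_of_continuousOn
    (P.hq.continuousOn (s := Icc P.z1 P.z2))
  set ε : ℝ × ℝ → ℝ := fun x => |x.1 - κ| * C1 + (|x.2 / x.1 - l / κ| * C2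
    + |1 / x.1 - 1 / κ| * C3) with hε
  set δ : ℝ × ℝ → ℝ := fun x => dist (P.initialAngle x.1) (P.initialAngle κ) with hδ
  have hbound : ∀ x : ℝ × ℝ, 0 < x.1 → dist (P.prufer x.1 x.2 P.z2) (P.prufer κ l P.z2)
      ≤ gronwallBound (δ x) K (ε x) (P.z2 - P.z1) := by
    intro x hx
    refine isAngle_prufer.dist_le isAngle_prufer (fun t ht => hK t ht)
      (by rw [prufer_left, prufer_left]) (fun t ht => ?_) (right_mem_Icc.2 P.hz.le)
    refine add_le_add ?_ ?_
    · have : P.coeffA x.1 t - P.coeffA κ t = (x.1 - κ) * P.coeffA 1 t := by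
        unfold coeffA; ring
      rw [this, abs_mul]
      exact mul_le_mul_of_nonneg_left (hC1 t ht) (abs_nonneg _)
    · have : P.coeffB x.1 x.2 t - P.coeffB κ l t
          = (x.2 / x.1 - l / κ) * P.r t - (1 / x.1 - 1 / κ) * P.q t := by
        unfold coeffB; ring
      rw [this]
      refine (abs_sub _ _).trans (add_le_add ?_ ?_) <;> rw [abs_mul]
      · exact mul_le_mul_of_nonneg_left (hC2 t ht) (abs_nonneg _)
      · exact mul_le_mul_of_nonneg_left (hC3 t ht) (abs_nonneg _)
  have h1 : Tendsto (fun x : ℝ × ℝ => x.1) (𝓝 (κ, l)) (𝓝 κ) := continuous_fst.tendsto _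
  have h2 : Tendsto (fun x : ℝ × ℝ => x.2) (𝓝 (κ, l)) (𝓝 l) := continuous_snd.tendsto _
  have hδ0 : Tendsto δ (𝓝 (κ, l)) (𝓝 0) :=
    tendsto_iff_dist_tendsto_zero.1 ((continuousAt_initialAngle hκ).tendsto.comp h1)
  have hε0 : Tendsto ε (𝓝 (κ, l)) (𝓝 0) := by
    have := ((h1.sub_const κ).abs.mul_const C1).add
      ((((h2.div h1 hκ.ne').sub_const (l / κ)).abs.mul_const C2).add
      ((((tendsto_const_nhds (x := (1 : ℝ))).div h1 hκ.ne').sub_const (1 / κ)).abs.mul_const C3))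
    simpa [hε, one_div] using this
  have hg : Tendsto (fun x => gronwallBound (δ x) K (ε x) (P.z2 - P.z1)) (𝓝 (κ, l)) (𝓝 0) := by
    by_cases hK0 : K = 0
    · simp only [hK0, gronwallBound_K0]
      simpa using hδ0.add (hε0.mul_const (P.z2 - P.z1))
    · simp only [gronwallBound_of_K_ne_0 hK0]
      simpa using (hδ0.mul_const (exp (K * (P.z2 - P.z1)))).add
        ((hε0.div_const K).mul_const (exp (K * (P.z2 - P.z1)) - 1))
  refine tendsto_iff_dist_tendsto_zero.2 (squeeze_zero' (.of_forall fun _ => dist_nonneg) ?_ hg)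
  filter_upwards [h1.eventually (lt_mem_nhds hκ)] with x hx using hbound x hx

theorem continuous_prufer_one : Continuous fun l => P.prufer 1 l P.z2 := by
  have := P.continuousOn_prufer_right.comp_continuous
    (f := fun l : ℝ => ((1 : ℝ), l)) (by fun_prop) (by simp)
  exact this

theorem monotone_prufer_one : Monotone fun l => P.prufer 1 l P.z2 := by
  intro l l' hl
  refine isAngle_prufer.le_of_le isAngle_prufer P.continuousOn_coeffA P.continuousOn_coeffB
    (fun t ht => le_rfl) (fun t ht => ?_) (by rw [prufer_left, prufer_left])
    (right_mem_Icc.2 P.hz.le)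
  have := P.hrpos t ht
  unfold coeffB
  gcongr

theorem exists_prufer_one_le {ε : ℝ} (hε : 0 < ε) : ∃ l0, ∀ l ≤ l0, P.prufer 1 l P.z2 ≤ ε := by
  have hne : (Icc P.z1 P.z2).Nonempty := nonempty_Icc.2 P.hz.le
  obtain ⟨a, ha⟩ := isCompact_Icc.exists_bound_of_continuousOn (P.continuousOn_coeffA (κ := 1))
  obtain ⟨C, hC⟩ := isCompact_Icc.exists_bound_of_continuousOn
    (P.hq.continuousOn (s := Icc P.z1 P.z2))
  obtain ⟨z0, hz0, hr0⟩ := isCompact_Icc.exists_isMinOn hne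
    (P.hr.continuous.continuousOn (s := Icc P.z1 P.z2))
  have hC0 : 0 ≤ C := (norm_nonneg _).trans (hC z0 hz0)
  have ha0 : 0 ≤ a := (norm_nonneg _).trans (ha z0 hz0)
  have hr := P.hrpos z0 hz0
  have hα := P.initialAngle_lt_pi (κ := 1)
  set ε' := min ε (min (π / 2) (π - P.initialAngle 1)) with hε'
  have h0 : 0 < ε' := lt_min hε (lt_min (by positivity) (by linarith))
  have h1 : ε' ≤ π / 2 := (min_le_right _ _).trans (min_le_left _ _)
  have h2 : ε' ≤ π - P.initialAngle 1 := (min_le_right _ _).trans (min_le_right _ _)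
  have hs : 0 < sin ε' := sin_pos_of_pos_of_lt_pi h0 (by linarith [pi_pos])
  have hyx : 0 < P.z2 - P.z1 := sub_pos.2 P.hz
  have hb : 0 < (a + π / (P.z2 - P.z1) + 1) / sin ε' ^ 2 := by positivity
  set β := (a + π / (P.z2 - P.z1) + 1) / sin ε' ^ 2 with hβ
  refine ⟨-((β + C) / P.r z0), fun l hl => ?_⟩
  refine (isAngle_prufer.le_of_barrier P.hz h0 h1 (by rw [prufer_left]; linarith)
    (fun t ht => (le_abs_self _).trans (ha t ht)) ha0 fun t ht => ?_).trans (min_le_left _ _)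
  have hl0 : l ≤ 0 := hl.trans (neg_nonpos.2 (by positivity))
  have h3 : l * P.r t ≤ -(β + C) := by
    calc l * P.r t ≤ l * P.r z0 := mul_le_mul_of_nonpos_left (hr0 ht) hl0
      _ ≤ -((β + C) / P.r z0) * P.r z0 := mul_le_mul_of_nonneg_right hl hr.le
      _ = -(β + C) := by field_simp
  have h4 : -P.q t ≤ C := (neg_le_abs _).trans (hC t ht)
  have h5 : P.coeffB 1 l t ≤ -β := by
    rw [coeffB, div_one]
    linarith
  have h6 : P.coeffB 1 l t * sin ε' ^ 2 ≤ -β * sin ε' ^ 2 :=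
    mul_le_mul_of_nonneg_right h5 (by positivity)
  have h7 : β * sin ε' ^ 2 = a + π / (P.z2 - P.z1) + 1 := div_mul_cancel₀ _ (by positivity)
  linarith

/-- Comparison of the scaled angle with the unscaled one, as long as the latter stays
below `π`. -/
theorem prufer_transfer (hκ : 0 < κ) (h : P.prufer 1 l P.z2 < π) :
    P.prufer κ l P.z2 < π ∧ ∃ m, 0 < m ∧
      sin (P.prufer 1 l P.z2) = m * sin (P.prufer κ l P.z2) ∧
      cos (P.prufer 1 l P.z2) = m * (κ * cos (P.prufer κ l P.z2)) := by
  have hx : P.z1 ∈ Icc P.z1 P.z2 := left_mem_Icc.2 P.hz.le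
  have hy : P.z2 ∈ Icc P.z1 P.z2 := right_mem_Icc.2 P.hz.le
  have hy' : P.z2 ∈ Ioc P.z1 P.z2 := right_mem_Ioc.2 P.hz
  obtain ⟨ρ, hpos, h1, h2⟩ := isAngle_prufer.exists_solution P.hz.le
    (P.continuousOn_coeffA (κ := 1)) (P.continuousOn_coeffB (κ := 1) (l := l))
  obtain ⟨σ, hσ, hσ0⟩ := isAngle_prufer.exists_radius (P.continuousOn_coeffA (κ := κ))
    (P.continuousOn_coeffB (κ := κ) (l := l)) (v := fun t => ρ t * sin (P.prufer 1 l t))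
    (u := fun t => ρ t * cos (P.prufer 1 l t) / κ)
    (fun t ht => (h1 t ht).continuousWithinAt)
    (fun t ht => ((h2 t ht).div_const κ).continuousWithinAt)
    (fun t ht => by
      convert! (h1 t (Ioo_subset_Icc_self ht)).hasDerivAt (Icc_mem_nhds ht.1 ht.2) using 1
      unfold coeffA
      field_simp)
    (fun t ht => by
      convert! ((h2 t (Ioo_subset_Icc_self ht)).hasDerivAt
        (Icc_mem_nhds ht.1 ht.2)).div_const κ using 1
      unfold coeffB
      ring)
    (by
      rw [P.prufer_left (κ := κ)]
      refine P.initialAngle_direction hκ.ne' ?_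
      have := P.initialAngle_spec one_ne_zero
      rw [prufer_left, mul_div_cancel₀ _ hκ.ne']
      linear_combination ρ P.z1 * this)
  have hsin : ∀ t ∈ Ioc P.z1 P.z2, 0 < sin (P.prufer 1 l t) := by
    intro t ht
    refine sin_pos_of_pos_of_lt_pi (prufer_pos one_pos ht) ?_
    by_contra! hge
    rcases ht.2.eq_or_lt with rfl | hlt
    · linarith
    · have := isAngle_prufer.int_mul_pi_lt (P.continuousOn_coeffA (κ := 1))
        (P.continuousOn_coeffB (κ := 1) (l := l)) (fun z hz => P.coeffA_pos one_pos hz) 1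
        (Ioc_subset_Icc_self ht) hy hlt (by simpa using hge)
      simp only [Int.cast_one, one_mul] at this
      linarith
  have hlt : P.prufer κ l P.z2 < π := by
    by_contra! hge
    obtain ⟨t, ht, hte⟩ := intermediate_value_Icc P.hz.le
      (isAngle_prufer (P := P) (κ := κ) (l := l)).continuousOn
      ⟨by rw [prufer_left]; exact P.initialAngle_lt_pi.le, hge⟩
    have hne : t ≠ P.z1 := by
      rintro rfl
      rw [prufer_left] at hte
      exact P.initialAngle_lt_pi.ne hte
    have ht' : t ∈ Ioc P.z1 P.z2 := ⟨lt_of_le_of_ne ht.1 hne.symm, ht.2⟩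
    have := (hσ t ht).1
    rw [hte, sin_pi, mul_zero] at this
    exact (mul_pos (hpos t) (hsin t ht')).ne' this
  have hs := sin_pos_of_pos_of_lt_pi (prufer_pos (P := P) (l := l) hκ hy') hlt
  have hs1 := hsin _ hy'
  obtain ⟨e1, e2⟩ := hσ _ hy
  have hρ := hpos P.z2
  refine ⟨hlt, σ P.z2 / ρ P.z2, div_pos ?_ hρ, ?_, ?_⟩
  · exact (mul_pos_iff_of_pos_right hs).1 (e1 ▸ mul_pos hρ hs1)
  · rw [div_mul_eq_mul_div, ← e1]
    field_simp
  · rw [div_mul_eq_mul_div, eq_div_iff hρ.ne']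
    rw [div_eq_iff hκ.ne'] at e2
    linear_combination e2

end SLP

namespace Prufer
open Real Set

/-- A continuous nondecreasing function that meets the levels `k * π` exactly at the members
`lam m, lam (m + 1), …` of a strictly increasing sequence meets level `j * π` at `lam (m + j)`. -/
theorem level_eq {lam : ℕ → ℝ} (hlam : StrictMono lam) {I : Set ℝ} (hI : I.OrdConnected)
    {g : ℝ → ℝ} (hc : ContinuousOn g I) (hm : MonotoneOn g I) {m : ℕ}
    (hmem : ∀ n, lam n ∈ I ↔ m ≤ n) (heig : ∀ n, m ≤ n → ∃ k : ℤ, g (lam n) = k * π)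
    (hall : ∀ μ ∈ I, (∃ k : ℤ, g μ = k * π) → ∃ n, μ = lam n)
    (hlow : ∀ μ ∈ I, -π < g μ) (hstart : ∃ μ ∈ I, g μ ≤ 0) (j : ℕ) :
    g (lam (m + j)) = j * π := by
  have hivt : ∀ s ∈ I, ∀ t ∈ I, s ≤ t → ∀ k : ℤ, g s ≤ k * π → k * π ≤ g t →
      ∃ n, lam n ∈ Icc s t ∧ g (lam n) = k * π := by
    intro s hs t ht hst k h1 h2
    obtain ⟨μ, hμ, e⟩ := intermediate_value_Icc hst (hc.mono (hI.out hs ht)) ⟨h1, h2⟩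
    obtain ⟨n, rfl⟩ := hall μ (hI.out hs ht hμ) ⟨k, e⟩
    exact ⟨n, hμ, e⟩
  induction j with
  | zero =>
    have hmI := (hmem m).2 le_rfl
    obtain ⟨k, hk⟩ := heig m le_rfl
    rw [add_zero, hk]
    have h1 : (-1 : ℤ) < k := by
      have := hlow _ hmI
      rw [hk] at this
      have h : ((-1 : ℤ) : ℝ) * π < k * π := by push_cast; linarith
      exact_mod_cast lt_of_mul_lt_mul_right h pi_pos.le
    rcases (show (0 : ℤ) ≤ k by omega).eq_or_lt with rfl | h2
    · simp
    · exfalso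
      obtain ⟨μ, hμ, hμ0⟩ := hstart
      have hk0 : 0 < g (lam m) := by
        rw [hk]
        have : (0 : ℝ) < k := by exact_mod_cast h2
        positivity
      have hlt : μ ≤ lam m := by
        by_contra! h
        have := hm hmI hμ h.le
        linarith
      obtain ⟨n, hn, hn'⟩ := hivt μ hμ _ hmI hlt 0 (by simpa using hμ0) (by simpa using hk0.le)
      have h3 := (hmem n).1 (hI.out hμ hmI hn)
      have h4 : n ≤ m := hlam.le_iff_le.1 hn.2
      obtain rfl : n = m := le_antisymm h4 h3
      simp only [Int.cast_zero, zero_mul] at hn'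
      linarith
  | succ j ih =>
    have hs := (hmem (m + j)).2 (by omega)
    have ht := (hmem (m + (j + 1))).2 (by omega)
    have hst : lam (m + j) < lam (m + (j + 1)) := hlam (by omega)
    obtain ⟨k, hk⟩ := heig (m + (j + 1)) (by omega)
    have hmon := hm hs ht hst.le
    have h1 : (j : ℤ) ≤ k := by
      rw [ih, hk] at hmon
      exact_mod_cast le_of_mul_le_mul_right hmon pi_pos
    have hno : ∀ n, lam n ∈ Ioo (lam (m + j)) (lam (m + (j + 1))) → False := by
      intro n hn
      have h3 := hlam.lt_iff_lt.1 hn.1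
      have h4 := hlam.lt_iff_lt.1 hn.2
      omega
    rcases h1.eq_or_lt with rfl | h2
    · exfalso
      obtain ⟨μ, hμ⟩ := exists_between hst
      have hμI := hI.out hs ht (Ioo_subset_Icc_self hμ)
      have e1 := hm hs hμI hμ.1.le
      have e2 := hm hμI ht hμ.2.le
      rw [ih] at e1
      rw [hk, Int.cast_natCast] at e2
      obtain ⟨n, rfl⟩ := hall μ hμI ⟨j, by rw [Int.cast_natCast]; exact le_antisymm e2 e1⟩
      exact hno n hμ
    · rcases (show (j : ℤ) + 1 ≤ k by omega).eq_or_lt with h3 | h3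
      · rw [hk, ← h3]
        push_cast
        ring
      · exfalso
        have hj : (j : ℝ) * π < ((j + 1 : ℤ) : ℝ) * π := by push_cast; nlinarith [pi_pos]
        have hk' : ((j + 1 : ℤ) : ℝ) * π < k * π :=
          mul_lt_mul_of_pos_right (by exact_mod_cast h3) pi_pos
        obtain ⟨n, hn, hn'⟩ := hivt _ hs _ ht hst.le (j + 1) (by rw [ih]; exact hj.le)
          (by rw [hk]; exact hk'.le)
        refine hno n ⟨lt_of_le_of_ne hn.1 fun e => ?_, lt_of_le_of_ne hn.2 fun e => ?_⟩
        · rw [← e, ih] at hn'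
          exact hj.ne hn'
        · rw [e, hk] at hn'
          exact hk'.ne' hn'

/-- The angle of the direction `(a + μ * c, b + μ * d)`, up to orientation. -/
theorem exists_direction_angle {a b c d : ℝ} (hD : 0 < b * c - a * d) :
    ∃ ψ : ℝ → ℝ, Continuous ψ ∧ Antitone ψ ∧ (∀ μ, -π < ψ μ ∧ ψ μ < π) ∧
      (∀ μ, ∃ m, m ≠ 0 ∧ sin (ψ μ) = m * (b + μ * d) ∧ cos (ψ μ) = m * (a + μ * c)) ∧
      (d = 0 → ∀ μ, 0 < ψ μ) ∧ (d ≠ 0 → ∀ μ, 0 < ψ μ ↔ μ < -b / d) := by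
  by_cases hd : d = 0
  · subst hd
    have hbc : 0 < b * c := by simpa using hD
    have hb : b ≠ 0 := fun h => by simp [h] at hbc
    have hcb : 0 ≤ c / b := by
      rw [show c / b = b * c / b ^ 2 by field_simp]
      positivity
    have hlt : ∀ x, arctan x < π / 2 := arctan_lt_pi_div_two
    have hgt : ∀ x, -(π / 2) < arctan x := neg_pi_div_two_lt_arctan
    refine ⟨fun μ => π / 2 - arctan (a / b + μ * (c / b)),
      continuous_const.sub (continuous_arctan.comp (by fun_prop)), fun μ μ' h => ?_,
      fun μ => ⟨by linarith [hlt (a / b + μ * (c / b)), pi_pos],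
        by linarith [hgt (a / b + μ * (c / b))]⟩, fun μ => ?_,
      fun _ μ => by linarith [hlt (a / b + μ * (c / b))], fun h => (h rfl).elim⟩
    · have : arctan (a / b + μ * (c / b)) ≤ arctan (a / b + μ' * (c / b)) := by
        apply arctan_mono
        gcongr
      simp only
      linarith
    · set x := arctan (a / b + μ * (c / b)) with hx
      have hcx : 0 < cos x := cos_arctan_pos _
      refine ⟨cos x / b, div_ne_zero hcx.ne' hb, ?_, ?_⟩
      · rw [sin_pi_div_two_sub, mul_zero, add_zero, div_mul_cancel₀ _ hb]
      · rw [cos_pi_div_two_sub, ← tan_mul_cos hcx.ne', hx, tan_arctan]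
        field_simp
  · set X : ℝ → ℝ := fun μ => (μ * (c ^ 2 + d ^ 2) + (a * c + b * d)) / (b * c - a * d) with hX
    have hlt : ∀ x, arctan x < π / 2 := arctan_lt_pi_div_two
    have hgt : ∀ x, -(π / 2) < arctan x := neg_pi_div_two_lt_arctan
    have hcd : 0 < c ^ 2 + d ^ 2 := by positivity
    have hcy : 0 < cos (arctan (c / d)) := cos_arctan_pos _
    have hm : ∀ μ, sin (-arctan (c / d) - arctan (X μ)) =
        (-(cos (arctan (X μ)) * cos (arctan (c / d)) * (c ^ 2 + d ^ 2)) / (d * (b * c - a * d)))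
          * (b + μ * d) ∧ cos (-arctan (c / d) - arctan (X μ)) =
        (-(cos (arctan (X μ)) * cos (arctan (c / d)) * (c ^ 2 + d ^ 2)) / (d * (b * c - a * d)))
          * (a + μ * c) := by
      intro μ
      have hcx : 0 < cos (arctan (X μ)) := cos_arctan_pos _
      have e1 : sin (arctan (X μ)) = X μ * cos (arctan (X μ)) := by
        rw [← tan_mul_cos hcx.ne', tan_arctan]
      have e2 : sin (arctan (c / d)) = c / d * cos (arctan (c / d)) := by
        rw [← tan_mul_cos hcy.ne', tan_arctan]
      have hD' := hD.ne'
      have e3 : c / d * d = c := div_mul_cancel₀ _ hd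
      have e4 : X μ * (b * c - a * d) = μ * (c ^ 2 + d ^ 2) + (a * c + b * d) :=
        div_mul_cancel₀ _ hD'
      have hdD := mul_ne_zero hd hD'
      rw [sin_sub, cos_sub, sin_neg, cos_neg, e1, e2]
      set p := cos (arctan (X μ)) * cos (arctan (c / d)) with hp
      have e5 := div_mul_cancel₀ (-(p * (c ^ 2 + d ^ 2))) hdD
      constructor <;> refine mul_right_cancel₀ hdD ?_
      · linear_combination (-p * (b * c - a * d)) * e3 - p * d * e4 - (b + μ * d) * e5
      · linear_combination (-p * X μ * (b * c - a * d)) * e3 - p * c * e4 - (a + μ * c) * e5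
    have hpi : ∀ μ, -π < -arctan (c / d) - arctan (X μ) ∧ -arctan (c / d) - arctan (X μ) < π :=
      fun μ => ⟨by linarith [hlt (X μ), hlt (c / d)], by linarith [hgt (X μ), hgt (c / d)]⟩
    refine ⟨fun μ => -arctan (c / d) - arctan (X μ),
      continuous_const.sub (continuous_arctan.comp (by fun_prop)), fun μ μ' h => ?_,
      hpi, fun μ => ⟨_, ?_, hm μ⟩, fun h => (hd h).elim, fun _ μ => ?_⟩
    · have : arctan (X μ) ≤ arctan (X μ') := by
        apply arctan_mono
        simp only [hX]
        gcongr
      simp only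
      linarith
    · have hcx : 0 < cos (arctan (X μ)) := cos_arctan_pos _
      have := hD.ne'
      exact div_ne_zero (neg_ne_zero.2 (by positivity)) (by positivity)
    · have hcx : 0 < cos (arctan (X μ)) := cos_arctan_pos _
      set w := cos (arctan (X μ)) * cos (arctan (c / d)) * (c ^ 2 + d ^ 2) / (b * c - a * d)
        with hw
      have hw0 : 0 < w := by positivity
      have es : sin (-arctan (c / d) - arctan (X μ)) = w * (-b / d - μ) := by
        rw [(hm μ).1, hw]
        field_simp
        ring
      constructor
      · intro h
        have := sin_pos_of_pos_of_lt_pi h (hpi μ).2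
        rw [es] at this
        linarith [(mul_pos_iff_of_pos_left hw0).1 this]
      · intro h
        by_contra! h0
        have := sin_nonpos_of_nonpos_of_neg_pi_le h0 (hpi μ).1.le
        rw [es] at this
        have := mul_pos hw0 (sub_pos.2 h)
        linarith

theorem direction_eq_iff {x y m θ ψ : ℝ} (hm : m ≠ 0) (hs : sin ψ = m * y) (hc : cos ψ = m * x) :
    x * sin θ = y * cos θ ↔ ∃ k : ℤ, θ - ψ = k * π := by
  have : (∃ k : ℤ, θ - ψ = k * π) ↔ sin (θ - ψ) = 0 := by
    rw [sin_eq_zero_iff]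
    exact exists_congr fun k => eq_comm
  rw [this, sin_sub, hs, hc, show sin θ * (m * x) - cos θ * (m * y) = m * (x * sin θ - y * cos θ)
    by ring, mul_eq_zero, or_iff_right hm, sub_eq_zero]

end Prufer

namespace SLP
open Real Set

variable {P : SLP} {κ l : ℝ} {v : ℝ → ℝ}

theorem IsRealPair.ncard_zeros (h : P.IsRealPair l v) (hκ : 0 < κ) (hc : P.c 0 = 0)
    (hd : P.d 0 = 0) {n : ℕ} (hn : n * π < P.prufer κ l P.z2)
    (hn' : P.prufer κ l P.z2 ≤ (n + 1) * π) :
    {z ∈ Ioo P.z1 P.z2 | v z = 0}.ncard = n := by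
  rw [h.zeros_eq hκ.ne' hc hd]
  exact isAngle_prufer.ncard_zeros P.continuousOn_coeffA P.continuousOn_coeffB
    (fun z hz => P.coeffA_pos hκ hz) P.hz (by rw [prufer_left]; exact P.initialAngle_nonneg)
    (by rw [prufer_left]; exact P.initialAngle_lt_pi) hn hn'

section Listing

variable {lam : ℕ → ℝ} {φ : ℕ → ℝ → ℝ}

theorem ncard_zeros_of_rightDefinite (hc : P.c 0 = 0) (hd : P.d 0 = 0)
    (hlam : StrictMono lam) (heig : ∀ n, P.IsRealPair (lam n) (φ n))
    (hall : ∀ μ v, P.IsRealPair μ v → ∃ n, μ = lam n)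
    (hD : 0 < P.b 1 * P.c 1 - P.a 1 * P.d 1) (n : ℕ) :
    (P.d 1 ≠ 0 → (lam n < -P.b 1 / P.d 1 → {z ∈ Ioo P.z1 P.z2 | φ n z = 0}.ncard = n) ∧
      (-P.b 1 / P.d 1 ≤ lam n → {z ∈ Ioo P.z1 P.z2 | φ n z = 0}.ncard = n - 1)) ∧
    (P.d 1 = 0 → {z ∈ Ioo P.z1 P.z2 | φ n z = 0}.ncard = n) := by
  obtain ⟨ψ, hψc, hψm, hψ, hdir, hψ0, hψ1⟩ := Prufer.exists_direction_angle hD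
  have hiff : ∀ μ, (∃ v, P.IsRealPair μ v) ↔ ∃ k : ℤ, P.prufer 1 μ P.z2 - ψ μ = k * π := by
    intro μ
    obtain ⟨m, hm, hs, hc'⟩ := hdir μ
    rw [exists_isRealPair_iff one_ne_zero hc hd, one_mul, Prufer.direction_eq_iff hm hs hc']
  have hpos : ∀ μ, 0 < P.prufer 1 μ P.z2 := fun μ => prufer_pos one_pos (right_mem_Ioc.2 P.hz)
  have hlev : P.prufer 1 (lam n) P.z2 - ψ (lam n) = n * π := by
    have := Prufer.level_eq hlam (I := univ) ordConnected_univ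
      (g := fun μ => P.prufer 1 μ P.z2 - ψ μ) (m := 0)
      (continuous_prufer_one.sub hψc).continuousOn
      (fun μ _ μ' _ h => sub_le_sub (monotone_prufer_one h) (hψm h)) (by simp)
      (fun n _ => (hiff _).1 ⟨_, heig n⟩)
      (fun μ _ h => by
        obtain ⟨v, hv⟩ := (hiff μ).2 h
        exact hall μ v hv)
      (fun μ _ => by linarith [hpos μ, hψ μ])
      (by
        obtain ⟨μ, hμ⟩ : ∃ μ, 0 < ψ μ := by
          by_cases hd1 : P.d 1 = 0
          · exact ⟨0, hψ0 hd1 0⟩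
          · exact ⟨-P.b 1 / P.d 1 - 1, (hψ1 hd1 _).2 (by linarith)⟩
        obtain ⟨l0, hl0⟩ := P.exists_prufer_one_le hμ
        exact ⟨min l0 μ, mem_univ _, sub_nonpos.2
          ((hl0 _ (min_le_left _ _)).trans (hψm (min_le_right _ _)))⟩) n
    simpa using this
  have hup : 0 < ψ (lam n) → {z ∈ Ioo P.z1 P.z2 | φ n z = 0}.ncard = n := fun h =>
    (heig n).ncard_zeros one_pos hc hd (by linarith)
      (by linarith [(hψ (lam n)).2])
  refine ⟨fun hd1 => ⟨fun h => hup ((hψ1 hd1 _).2 h), fun h => ?_⟩, fun hd1 => hup (hψ0 hd1 _)⟩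
  have h0 : ψ (lam n) ≤ 0 := not_lt.1 fun h' => absurd ((hψ1 hd1 _).1 h') (not_lt.2 h)
  rcases n with _ | n
  · have := hpos (lam 0)
    simp only [CharP.cast_eq_zero, zero_mul] at hlev
    linarith
  · have h1 := (hψ (lam (n + 1))).1
    push_cast at hlev
    rw [Nat.add_sub_cancel]
    exact (heig (n + 1)).ncard_zeros one_pos hc hd (by linarith) (by linarith)

end Listing

end SLP

namespace SLP
open Real Set

variable {P : SLP} {κ l : ℝ} {v : ℝ → ℝ}

theorem exists_le_prufer_neg (P : SLP) {ε : ℝ} (hε : 0 < ε) :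
    ∃ s0, ∀ s, 0 < s → s0 ≤ s → π / 2 - ε ≤ P.prufer s (-s) P.z2 := by
  obtain ⟨C1, hC1⟩ := isCompact_Icc.exists_bound_of_continuousOn
    (P.hp.continuous.continuousOn (s := Icc P.z1 P.z2))
  obtain ⟨C2, hC2⟩ := isCompact_Icc.exists_bound_of_continuousOn
    (P.hr.continuous.continuousOn (s := Icc P.z1 P.z2))
  obtain ⟨C3, hC3⟩ := isCompact_Icc.exists_bound_of_continuousOn
    (P.hq.continuousOn (s := Icc P.z1 P.z2))
  have hx : P.z1 ∈ Icc P.z1 P.z2 := left_mem_Icc.2 P.hz.le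
  have hC1' : 0 < C1 := (P.hppos _ hx).trans_le ((le_abs_self _).trans (hC1 _ hx))
  have hC2' : 0 ≤ C2 := (norm_nonneg _).trans (hC2 _ hx)
  have hC3' : 0 ≤ C3 := (norm_nonneg _).trans (hC3 _ hx)
  set ε' := min ε (π / 2) with hε'
  have h0 : 0 < ε' := lt_min hε (by positivity)
  have h1 : ε' ≤ π / 2 := min_le_right _ _
  have hs : 0 < sin ε' := sin_pos_of_pos_of_lt_pi h0 (by linarith [pi_pos])
  set β := (π / (P.z2 - P.z1) + (C2 + C3) + 1) * C1 / sin ε' ^ 2 with hβ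
  refine ⟨max 1 β, fun s hs0 hs1 => ?_⟩
  have hs2 : 1 ≤ s := (le_max_left _ _).trans hs1
  have hs3 : β ≤ s := (le_max_right _ _).trans hs1
  refine le_trans (by linarith [min_le_left ε (π / 2)])
    (isAngle_prufer.le_of_barrier' P.hz h0 h1 (b := C2 + C3)
      (by rw [prufer_left]; exact P.initialAngle_nonneg) (fun t ht => ?_) (by positivity)
      fun t ht => ?_)
  · have e : P.coeffB s (-s) t = -(P.r t + P.q t / s) := by
      unfold coeffB
      field_simp
      ring
    have h2 : P.r t ≤ C2 := (le_abs_self _).trans (hC2 t ht)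
    have h3 : P.q t / s ≤ C3 := by
      rw [div_le_iff₀ hs0]
      exact ((le_abs_self _).trans (hC3 t ht)).trans (le_mul_of_one_le_right hC3' hs2)
    rw [e]
    linarith
  · have h2 : s / C1 ≤ P.coeffA s t := by
      unfold coeffA
      have := P.hppos t ht
      have : P.p t ≤ C1 := (le_abs_self _).trans (hC1 t ht)
      gcongr
    have h3 : β / C1 * sin ε' ^ 2 ≤ P.coeffA s t * sin ε' ^ 2 := by
      refine mul_le_mul_of_nonneg_right (le_trans ?_ h2) (by positivity)
      gcongr
    have h4 : β / C1 * sin ε' ^ 2 = π / (P.z2 - P.z1) + (C2 + C3) + 1 := by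
      rw [hβ]
      field_simp
    linarith

/-- The sign conditions of a left-definite problem in which exactly the right boundary condition
depends on the eigenvalue. -/
structure IsLeftDefiniteRight (P : SLP) : Prop where
  c_zero : P.c 0 = 0
  d_zero : P.d 0 = 0
  q_nonneg : ∀ z ∈ Icc P.z1 P.z2, 0 ≤ P.q z
  left : P.b 0 = 0 ∨ 0 ≤ P.a 0 / P.b 0
  ac : 0 ≤ P.a 1 * P.c 1
  bd : 0 ≤ P.b 1 * P.d 1
  ad : P.a 1 * P.d 1 ≤ 0
  lt : P.b 1 * P.c 1 < P.a 1 * P.d 1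

namespace IsLeftDefiniteRight

theorem bc (h : P.IsLeftDefiniteRight) : P.b 1 * P.c 1 < 0 := h.lt.trans_le h.ad

theorem b_ne (h : P.IsLeftDefiniteRight) : P.b 1 ≠ 0 := left_ne_zero_of_mul h.bc.ne

theorem c_ne (h : P.IsLeftDefiniteRight) : P.c 1 ≠ 0 := right_ne_zero_of_mul h.bc.ne

theorem ab (h : P.IsLeftDefiniteRight) : P.a 1 * P.b 1 ≤ 0 := by
  have h1 := mul_nonpos_of_nonneg_of_nonpos h.ac h.bc.le
  have h2 : 0 < P.c 1 ^ 2 := by have := h.c_ne; positivity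
  refine nonpos_of_mul_nonpos_left ?_ h2
  linarith

theorem cd (h : P.IsLeftDefiniteRight) : P.c 1 * P.d 1 ≤ 0 := by
  have h1 := mul_nonpos_of_nonneg_of_nonpos h.bd h.bc.le
  have h2 : 0 < P.b 1 ^ 2 := by have := h.b_ne; positivity
  refine nonpos_of_mul_nonpos_left ?_ h2
  linarith

theorem initialAngle_le (h : P.IsLeftDefiniteRight) (hκ : 0 < κ) :
    P.initialAngle κ ≤ π / 2 := by
  unfold initialAngle
  split_ifs with hb
  · positivity
  · have h1 := h.left.resolve_left hb
    have : 0 ≤ arctan (P.a 0 / (κ * P.b 0)) := by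
      rw [arctan_nonneg, mul_comm, ← div_div]
      positivity
    linarith

theorem initialAngle_mono (h : P.IsLeftDefiniteRight) {κ' : ℝ} (hκ : 0 < κ) (hκκ : κ ≤ κ') :
    P.initialAngle κ ≤ P.initialAngle κ' := by
  unfold initialAngle
  split_ifs with hb
  · exact le_rfl
  · have h1 := h.left.resolve_left hb
    refine sub_le_sub_left (arctan_mono ?_) _
    rw [mul_comm, ← div_div, mul_comm, ← div_div]
    gcongr

theorem monotoneOn_prufer_self (h : P.IsLeftDefiniteRight) :
    MonotoneOn (fun l => P.prufer l l P.z2) (Ioi 0) := by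
  intro l (hl : 0 < l) l' _ hll
  refine isAngle_prufer.le_of_le isAngle_prufer P.continuousOn_coeffA P.continuousOn_coeffB
    (fun t ht => ?_) (fun t ht => ?_)
    (by rw [prufer_left, prufer_left]; exact h.initialAngle_mono hl hll)
    (right_mem_Icc.2 P.hz.le)
  · have := P.hppos t ht
    unfold coeffA
    gcongr
  · have hq := h.q_nonneg t ht
    have hl' := hl.trans_le hll
    have e : ∀ s, 0 < s → P.coeffB s s t = P.r t - P.q t / s := fun s hs => by
      unfold coeffB
      field_simp
    rw [e l hl, e l' hl']
    gcongr

theorem monotoneOn_prufer_neg (h : P.IsLeftDefiniteRight) :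
    MonotoneOn (fun s => P.prufer s (-s) P.z2) (Ioi 0) := by
  intro l (hl : 0 < l) l' _ hll
  refine isAngle_prufer.le_of_le isAngle_prufer P.continuousOn_coeffA P.continuousOn_coeffB
    (fun t ht => ?_) (fun t ht => ?_)
    (by rw [prufer_left, prufer_left]; exact h.initialAngle_mono hl hll)
    (right_mem_Icc.2 P.hz.le)
  · have := P.hppos t ht
    unfold coeffA
    gcongr
  · have hq := h.q_nonneg t ht
    have hl' := hl.trans_le hll
    have e : ∀ s, 0 < s → P.coeffB s (-s) t = -P.r t - P.q t / s := fun s hs => by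
      unfold coeffB
      field_simp
    rw [e l hl, e l' hl']
    gcongr

theorem prufer_neg_lt (h : P.IsLeftDefiniteRight) {s : ℝ} (hs : 0 < s) :
    P.prufer s (-s) P.z2 < π / 2 := by
  refine isAngle_prufer.lt_pi_div_two P.continuousOn_coeffA P.continuousOn_coeffB
    (fun t ht => ?_) (by rw [prufer_left]; exact h.initialAngle_le hs) (right_mem_Ioc.2 P.hz)
  have h1 := h.q_nonneg t ht
  have h2 := mul_pos hs (P.hrpos t ht)
  exact div_neg_of_neg_of_pos (by linarith) hs

/-- Close to `l = 0` all scaled angles are below `π`, and the boundary mismatch has a fixed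
sign. -/
theorem exists_near_zero (h : P.IsLeftDefiniteRight) (h0 : ¬ ∃ v, P.IsRealPair 0 v) :
    ∃ δ, 0 < δ ∧ ∀ l, |l| < δ → ∀ κ, 0 < κ → P.prufer κ l P.z2 < π ∧
      P.b 1 * ((P.a 1 + l * P.c 1) * sin (P.prufer κ l P.z2) -
        (P.b 1 + l * P.d 1) * (κ * cos (P.prufer κ l P.z2))) < 0 := by
  rw [exists_isRealPair_iff one_ne_zero h.c_zero h.d_zero] at h0
  have hpos : 0 < P.prufer 1 0 P.z2 := prufer_pos one_pos (right_mem_Ioc.2 P.hz)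
  have hle : P.prufer 1 0 P.z2 ≤ π / 2 := by
    refine isAngle_prufer.le_pi_div_two P.continuousOn_coeffA P.continuousOn_coeffB
      (fun t ht => ?_) (by rw [prufer_left]; exact h.initialAngle_le one_pos)
      (right_mem_Icc.2 P.hz.le)
    simpa [coeffB] using h.q_nonneg t ht
  set H : ℝ → ℝ := fun l => P.b 1 * ((P.a 1 + l * P.c 1) * sin (P.prufer 1 l P.z2) -
        (P.b 1 + l * P.d 1) * (1 * cos (P.prufer 1 l P.z2))) with hH
  have hHc : Continuous H := by
    have := P.continuous_prufer_one
    have h1 := continuous_sin.comp this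
    have h2 := continuous_cos.comp this
    simp only [Function.comp_def] at h1 h2
    fun_prop
  have hH0 : H 0 < 0 := by
    refine lt_of_le_of_ne ?_ (mul_ne_zero h.b_ne (sub_ne_zero.2 h0))
    have h1 : 0 ≤ sin (P.prufer 1 0 P.z2) := sin_nonneg_of_nonneg_of_le_pi hpos.le (by linarith)
    have h2 : 0 ≤ cos (P.prufer 1 0 P.z2) := cos_nonneg_of_mem_Icc ⟨by linarith, hle⟩
    have h3 := mul_nonpos_of_nonpos_of_nonneg h.ab h1
    have h4 := mul_nonneg (sq_nonneg (P.b 1)) h2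
    simp only [hH]
    linarith
  have hev : ∀ᶠ l in 𝓝 0, P.prufer 1 l P.z2 < π ∧ H l < 0 :=
    (P.continuous_prufer_one.continuousAt.eventually_lt_const (by linarith)).and
      (hHc.continuousAt.eventually_lt_const hH0)
  obtain ⟨δ, hδ, hδ'⟩ := Metric.eventually_nhds_iff.1 hev
  refine ⟨δ, hδ, fun l hl κ hκ => ?_⟩
  obtain ⟨h1, h2⟩ := hδ' (y := l) (by simpa [Real.dist_eq] using hl)
  obtain ⟨h3, m, hm, es, ec⟩ := prufer_transfer hκ h1
  refine ⟨h3, ?_⟩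
  simp only [hH, es, ec] at h2
  by_contra! hn
  have := mul_nonneg hm.le hn
  linarith

end IsLeftDefiniteRight

end SLP

namespace SLP
namespace IsLeftDefiniteRight
open Real Set

variable {P : SLP} {κ l : ℝ} {v : ℝ → ℝ}

theorem exists_neg_iff (h : P.IsLeftDefiniteRight) {s : ℝ} (hs : 0 < s) :
    (∃ v, P.IsRealPair (-s) v) ↔
      (P.a 1 * P.b 1 / s - P.b 1 * P.c 1) * sin (P.prufer s (-s) P.z2) =
        (P.b 1 ^ 2 - s * (P.b 1 * P.d 1)) * cos (P.prufer s (-s) P.z2) := by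
  rw [exists_isRealPair_iff hs.ne' h.c_zero h.d_zero]
  constructor
  · intro e
    field_simp
    linear_combination P.b 1 * e
  · intro e
    field_simp at e
    refine mul_left_cancel₀ h.b_ne ?_
    linear_combination e

theorem sin_prufer_neg_pos (h : P.IsLeftDefiniteRight) {s : ℝ} (hs : 0 < s) :
    0 < sin (P.prufer s (-s) P.z2) :=
  sin_pos_of_pos_of_lt_pi (prufer_pos hs (right_mem_Ioc.2 P.hz))
    (by linarith [h.prufer_neg_lt hs, pi_pos])

theorem cos_prufer_neg_pos (h : P.IsLeftDefiniteRight) {s : ℝ} (hs : 0 < s) :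
    0 < cos (P.prufer s (-s) P.z2) :=
  cos_pos_of_mem_Ioo ⟨by linarith [prufer_pos (P := P) (l := -s) hs (right_mem_Ioc.2 P.hz), pi_pos],
    h.prufer_neg_lt hs⟩

theorem pos_of_neg_eigenvalue (h : P.IsLeftDefiniteRight) {s : ℝ} (hs : 0 < s)
    (he : ∃ v, P.IsRealPair (-s) v) :
    0 < P.a 1 * P.b 1 / s - P.b 1 * P.c 1 ∧ 0 < P.b 1 ^ 2 - s * (P.b 1 * P.d 1) := by
  rw [h.exists_neg_iff hs] at he
  have h1 := h.sin_prufer_neg_pos hs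
  have h2 := h.cos_prufer_neg_pos hs
  have hb : 0 < P.b 1 ^ 2 := by have := h.b_ne; positivity
  have key : 0 < P.b 1 ^ 2 - s * (P.b 1 * P.d 1) := by
    by_contra! hY
    have hX : P.a 1 * P.b 1 / s - P.b 1 * P.c 1 ≤ 0 := by
      by_contra! hX
      have := mul_pos hX h1
      have := mul_nonpos_of_nonpos_of_nonneg hY h2.le
      linarith
    have hX' : P.a 1 * P.b 1 ≤ s * (P.b 1 * P.c 1) := by
      have := (div_le_iff₀ hs).1 (sub_nonpos.1 hX)
      linarith
    have hbd : 0 < P.b 1 * P.d 1 :=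
      (mul_pos_iff_of_pos_left hs).1 (by linarith)
    have e1 := mul_le_mul_of_nonneg_left hX' hbd.le
    have e2 : P.b 1 ^ 2 * (-(P.b 1 * P.c 1)) ≤ s * (P.b 1 * P.d 1) * (-(P.b 1 * P.c 1)) :=
      mul_le_mul_of_nonneg_right (by linarith) (neg_pos.2 h.bc).le
    have e3 : P.b 1 ^ 2 * (P.b 1 * P.c 1) < P.b 1 ^ 2 * (P.a 1 * P.d 1) :=
      mul_lt_mul_of_pos_left h.lt hb
    linarith
  exact ⟨(mul_pos_iff_of_pos_right h1).1 (he ▸ mul_pos key h2), key⟩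

/-- Everything between two negative eigenvalues would be an eigenvalue. -/
theorem neg_eigenvalue_between (h : P.IsLeftDefiniteRight) {s t s' : ℝ} (hs : 0 < s)
    (hst : s ≤ t) (hts : t ≤ s') (he : ∃ v, P.IsRealPair (-s) v)
    (he' : ∃ v, P.IsRealPair (-s') v) : ∃ v, P.IsRealPair (-t) v := by
  have ht := hs.trans_le hst
  have hs' := ht.trans_le hts
  obtain ⟨hX, hY⟩ := h.pos_of_neg_eigenvalue hs he
  obtain ⟨hX', hY'⟩ := h.pos_of_neg_eigenvalue hs' he'
  rw [h.exists_neg_iff hs] at he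
  rw [h.exists_neg_iff hs'] at he'
  rw [h.exists_neg_iff ht]
  have hpos : ∀ u, 0 < u → 0 < P.prufer u (-u) P.z2 := fun u hu =>
    prufer_pos hu (right_mem_Ioc.2 P.hz)
  have hXm : ∀ u w, 0 < u → u ≤ w → P.a 1 * P.b 1 / u - P.b 1 * P.c 1 ≤
      P.a 1 * P.b 1 / w - P.b 1 * P.c 1 := fun u w hu hw => by
    have := div_le_div_of_nonneg_left (neg_nonneg.2 h.ab) hu hw
    rw [neg_div, neg_div] at this
    linarith
  have hYm : ∀ u w, u ≤ w → P.b 1 ^ 2 - w * (P.b 1 * P.d 1) ≤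
      P.b 1 ^ 2 - u * (P.b 1 * P.d 1) := fun u w hw => by
    have := mul_le_mul_of_nonneg_right hw h.bd
    linarith
  have hsm : ∀ u w, 0 < u → u ≤ w → sin (P.prufer u (-u) P.z2) ≤ sin (P.prufer w (-w) P.z2) :=
    fun u w hu hw => by
      have hw' := hu.trans_le hw
      exact sin_le_sin_of_le_of_le_pi_div_two (by linarith [hpos u hu, pi_pos])
        (h.prufer_neg_lt hw').le (h.monotoneOn_prufer_neg hu hw' hw)
  have hcm : ∀ u w, 0 < u → u ≤ w → cos (P.prufer w (-w) P.z2) ≤ cos (P.prufer u (-u) P.z2) :=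
    fun u w hu hw => by
      have hw' := hu.trans_le hw
      exact cos_le_cos_of_nonneg_of_le_pi (hpos u hu).le
        (by linarith [h.prufer_neg_lt hw', pi_pos]) (h.monotoneOn_prufer_neg hu hw' hw)
  have hXt := hX.trans_le (hXm s t hs hst)
  have hYt := hY'.trans_le (hYm t s' hts)
  apply le_antisymm
  · calc _ ≤ _ := mul_le_mul (hXm t s' ht hts) (hsm t s' ht hts)
          (h.sin_prufer_neg_pos ht).le hX'.le
      _ = _ := he'
      _ ≤ _ := mul_le_mul (hYm t s' hts) (hcm t s' ht hts) (h.cos_prufer_neg_pos hs').le hYt.le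
  · calc _ ≤ _ := mul_le_mul (hYm s t hst) (hcm s t hs hst) (h.cos_prufer_neg_pos ht).le hY.le
      _ = _ := he.symm
      _ ≤ _ := mul_le_mul (hXm s t hs hst) (hsm s t hs hst)
          (h.sin_prufer_neg_pos hs).le hXt.le

theorem exists_neg_eigenvalue (h : P.IsLeftDefiniteRight) (h0 : ¬ ∃ v, P.IsRealPair 0 v) :
    ∃ s, 0 < s ∧ ∃ v, P.IsRealPair (-s) v := by
  set H : ℝ → ℝ := fun s => (P.a 1 * P.b 1 - s * (P.b 1 * P.c 1)) * sin (P.prufer s (-s) P.z2) -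
    (P.b 1 ^ 2 - s * (P.b 1 * P.d 1)) * (s * cos (P.prufer s (-s) P.z2)) with hH
  have hb : 0 < P.b 1 ^ 2 := by have := h.b_ne; positivity
  have hHc : ContinuousOn H (Ioi 0) := by
    have hc : ContinuousOn (fun s => P.prufer s (-s) P.z2) (Ioi 0) :=
      P.continuousOn_prufer_right.comp (f := fun s : ℝ => (s, -s)) (by fun_prop) fun s hs => hs
    have h1 := continuous_sin.comp_continuousOn hc
    have h2 := continuous_cos.comp_continuousOn hc
    simp only [Function.comp_def] at h1 h2
    fun_prop
  obtain ⟨s1, hs1, hn⟩ : ∃ s, 0 < s ∧ H s < 0 := by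
    obtain ⟨δ, hδ, hδ'⟩ := h.exists_near_zero h0
    refine ⟨δ / 2, half_pos hδ, ?_⟩
    have := (hδ' (-(δ / 2)) (by rw [abs_neg, abs_of_pos (half_pos hδ)]; exact half_lt_self hδ)
      (δ / 2) (half_pos hδ)).2
    simp only [hH]
    linarith
  obtain ⟨s2, hs2, hp⟩ : ∃ s, 0 < s ∧ 0 < H s := by
    by_cases hd : P.d 1 = 0
    · set η := -(P.b 1 * P.c 1) with hη
      have hη0 : 0 < η := neg_pos.2 h.bc
      set ε := min (π / 3) (η / (4 * P.b 1 ^ 2)) with hε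
      have hε0 : 0 < ε := lt_min (by positivity) (by positivity)
      obtain ⟨s0, hs0⟩ := P.exists_le_prufer_neg hε0
      set t := max (max 1 s0) (4 * (-(P.a 1 * P.b 1)) / η) with ht
      have ht0 : 0 < t := lt_of_lt_of_le one_pos ((le_max_left _ _).trans (le_max_left _ _))
      have hΘ := hs0 t ht0 ((le_max_right _ _).trans (le_max_left _ _))
      have hΘ' := h.prufer_neg_lt ht0
      have h1 : 1 / 2 ≤ sin (P.prufer t (-t) P.z2) := by
        rw [← sin_pi_div_six]
        refine sin_le_sin_of_le_of_le_pi_div_two (by linarith [pi_pos]) hΘ'.le ?_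
        have : ε ≤ π / 3 := min_le_left _ _
        linarith
      have h2 : cos (P.prufer t (-t) P.z2) ≤ η / (4 * P.b 1 ^ 2) := by
        rw [← sin_pi_div_two_sub]
        refine (sin_le (by linarith)).trans ?_
        have : ε ≤ η / (4 * P.b 1 ^ 2) := min_le_right _ _
        linarith
      have h3 : P.b 1 ^ 2 * cos (P.prufer t (-t) P.z2) ≤ η / 4 := by
        calc _ ≤ P.b 1 ^ 2 * (η / (4 * P.b 1 ^ 2)) := mul_le_mul_of_nonneg_left h2 hb.le
          _ = η / 4 := by field_simp [h.b_ne]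
      have h4 : -(P.a 1 * P.b 1) ≤ t * η / 4 := by
        have : 4 * (-(P.a 1 * P.b 1)) / η ≤ t := le_max_right _ _
        rw [div_le_iff₀ hη0] at this
        linarith
      refine ⟨t, ht0, ?_⟩
      have h5 : t * η * 3 / 4 * (1 / 2) ≤
          (P.a 1 * P.b 1 - t * (P.b 1 * P.c 1)) * sin (P.prufer t (-t) P.z2) :=
        mul_le_mul (by linarith) h1 (by norm_num) (by nlinarith [mul_pos ht0 hη0])
      have h6 := mul_le_mul_of_nonneg_left h3 ht0.le
      have h7 := mul_pos ht0 hη0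
      simp only [hH, hd]
      linarith
    · have hbd : 0 < P.b 1 / P.d 1 := by
        have : 0 < P.b 1 * P.d 1 := lt_of_le_of_ne h.bd (mul_ne_zero h.b_ne hd).symm
        rw [show P.b 1 / P.d 1 = P.b 1 * P.d 1 / P.d 1 ^ 2 by field_simp]
        positivity
      refine ⟨P.b 1 / P.d 1, hbd, ?_⟩
      have e1 : P.b 1 ^ 2 - P.b 1 / P.d 1 * (P.b 1 * P.d 1) = 0 := by
        field_simp
        ring
      have e2 : P.a 1 * P.b 1 - P.b 1 / P.d 1 * (P.b 1 * P.c 1) =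
          P.b 1 / P.d 1 * (P.a 1 * P.d 1 - P.b 1 * P.c 1) := by
        field_simp
      simp only [hH, e1, e2, zero_mul, sub_zero]
      exact mul_pos (mul_pos hbd (sub_pos.2 h.lt)) (h.sin_prufer_neg_pos hbd)
  obtain ⟨s, hs, hHs⟩ := (isPreconnected_Ioi (a := (0 : ℝ))).intermediate_value hs1 hs2 hHc
    ⟨hn.le, hp.le⟩
  refine ⟨s, hs, (exists_isRealPair_iff (ne_of_gt hs) h.c_zero h.d_zero).2 ?_⟩
  refine mul_left_cancel₀ h.b_ne ?_
  simp only [hH] at hHs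
  linarith

end IsLeftDefiniteRight
end SLP

namespace SLP
namespace IsLeftDefiniteRight
open Real Set

variable {P : SLP} {lam : ℕ → ℝ} {φ : ℕ → ℝ → ℝ}

theorem neg_and_pos (h : P.IsLeftDefiniteRight) (h0 : ¬ ∃ v, P.IsRealPair 0 v)
    (hlam : StrictMono lam) (heig : ∀ n, P.IsRealPair (lam n) (φ n))
    (hall : ∀ μ v, P.IsRealPair μ v → ∃ n, μ = lam n) : lam 0 < 0 ∧ 0 < lam 1 := by
  constructor
  · obtain ⟨s, hs, v, hv⟩ := h.exists_neg_eigenvalue h0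
    obtain ⟨n, hn⟩ := hall _ v hv
    linarith [hlam.monotone n.zero_le]
  · have hne : lam 1 ≠ 0 := fun e => h0 ⟨_, e ▸ heig 1⟩
    by_contra! hle
    have h1 : lam 1 < 0 := lt_of_le_of_ne hle hne
    have h01 : lam 0 < lam 1 := hlam one_pos
    obtain ⟨μ, hμ⟩ := exists_between h01
    obtain ⟨v, hv⟩ := h.neg_eigenvalue_between (s := -lam 1) (t := -μ) (s' := -lam 0)
      (by linarith) (by linarith) (by linarith) ⟨φ 1, by simpa using heig 1⟩
      ⟨φ 0, by simpa using heig 0⟩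
    obtain ⟨n, hn⟩ := hall _ v hv
    rw [neg_neg] at hn
    rw [hn] at hμ
    have h2 := hlam.lt_iff_lt.1 hμ.1
    have h3 := hlam.lt_iff_lt.1 hμ.2
    omega

theorem ncard_zeros_zero (h : P.IsLeftDefiniteRight) (h0 : ¬ ∃ v, P.IsRealPair 0 v)
    (hlam : StrictMono lam) (heig : ∀ n, P.IsRealPair (lam n) (φ n))
    (hall : ∀ μ v, P.IsRealPair μ v → ∃ n, μ = lam n) :
    {z ∈ Ioo P.z1 P.z2 | φ 0 z = 0}.ncard = 0 := by
  have hs : 0 < -lam 0 := neg_pos.2 (h.neg_and_pos h0 hlam heig hall).1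
  have h1 := h.prufer_neg_lt hs
  have h2 : 0 < P.prufer (-lam 0) (-(-lam 0)) P.z2 := prufer_pos hs (right_mem_Ioc.2 P.hz)
  rw [neg_neg] at h1 h2
  exact (heig 0).ncard_zeros hs h.c_zero h.d_zero (by simpa using h2)
    (by simp only [CharP.cast_eq_zero, zero_add, one_mul]; linarith [pi_pos])

theorem ncard_zeros_succ (h : P.IsLeftDefiniteRight) (h0 : ¬ ∃ v, P.IsRealPair 0 v)
    (hlam : StrictMono lam) (heig : ∀ n, P.IsRealPair (lam n) (φ n))
    (hall : ∀ μ v, P.IsRealPair μ v → ∃ n, μ = lam n) (j : ℕ) :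
    {z ∈ Ioo P.z1 P.z2 | φ (j + 1) z = 0}.ncard = j := by
  obtain ⟨hneg, hpos⟩ := h.neg_and_pos h0 hlam heig hall
  have hb : 0 < P.b 1 ^ 2 := by have := h.b_ne; positivity
  have hY : ∀ μ, 0 < μ → 0 < P.b 1 ^ 2 + μ * (P.b 1 * P.d 1) := fun μ hμ =>
    add_pos_of_pos_of_nonneg hb (mul_nonneg hμ.le h.bd)
  set F : ℝ → ℝ := fun μ => (P.a 1 * P.b 1 / μ + P.b 1 * P.c 1) /
    (P.b 1 ^ 2 + μ * (P.b 1 * P.d 1)) with hF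
  set ψ : ℝ → ℝ := fun μ => π / 2 - arctan (F μ) with hψ
  have hFneg : ∀ μ, 0 < μ → F μ < 0 := fun μ hμ => by
    refine div_neg_of_neg_of_pos (add_neg_of_nonpos_of_neg ?_ h.bc) (hY μ hμ)
    exact div_nonpos_of_nonpos_of_nonneg h.ab hμ.le
  have hFm : MonotoneOn F (Ioi 0) := by
    intro μ (hμ : 0 < μ) μ' _ hle
    have hμ' := hμ.trans_le hle
    simp only [hF]
    rw [div_le_div_iff₀ (hY μ hμ) (hY μ' hμ')]
    have e : (P.a 1 * P.b 1 / μ' + P.b 1 * P.c 1) * (P.b 1 ^ 2 + μ * (P.b 1 * P.d 1)) -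
        (P.a 1 * P.b 1 / μ + P.b 1 * P.c 1) * (P.b 1 ^ 2 + μ' * (P.b 1 * P.d 1)) =
        (μ' - μ) / (μ * μ') * (P.b 1 ^ 2 * (-(P.a 1 * P.b 1) - (μ + μ') * (P.a 1 * P.d 1)
          - μ * μ' * (P.c 1 * P.d 1))) := by
      field_simp
      ring
    have h1 : 0 ≤ (μ' - μ) / (μ * μ') := div_nonneg (sub_nonneg.2 hle) (by positivity)
    have h2 := mul_nonpos_of_nonneg_of_nonpos (add_pos hμ hμ').le h.ad
    have h3 := mul_nonpos_of_nonneg_of_nonpos (mul_pos hμ hμ').le h.cd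
    have h4 := h.ab
    have := mul_nonneg h1 (mul_nonneg hb.le (show 0 ≤ -(P.a 1 * P.b 1) -
      (μ + μ') * (P.a 1 * P.d 1) - μ * μ' * (P.c 1 * P.d 1) by linarith))
    linarith
  have hψ1 : ∀ μ, 0 < μ → π / 2 < ψ μ := fun μ hμ => by
    have := arctan_lt_zero.2 (hFneg μ hμ)
    simp only [hψ]
    linarith
  have hψ2 : ∀ μ, ψ μ < π := fun μ => by
    have := neg_pi_div_two_lt_arctan (F μ)
    simp only [hψ]
    linarith
  have hdir : ∀ μ, 0 < μ → ∃ m, 0 < P.b 1 * m ∧ sin (ψ μ) = m * ((P.b 1 + μ * P.d 1) * μ) ∧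
      cos (ψ μ) = m * (P.a 1 + μ * P.c 1) := fun μ hμ => by
    have hb1 := h.b_ne
    have hw : 0 < cos (arctan (F μ)) := cos_arctan_pos _
    have hY' := hY μ hμ
    have hbd : P.b 1 + μ * P.d 1 ≠ 0 := fun e => hY'.ne' (by linear_combination P.b 1 * e)
    refine ⟨P.b 1 * cos (arctan (F μ)) / (μ * (P.b 1 ^ 2 + μ * (P.b 1 * P.d 1))), ?_, ?_, ?_⟩
    · rw [show ∀ x y : ℝ, P.b 1 * (P.b 1 * x / y) = P.b 1 ^ 2 * x / y by intros; ring]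
      positivity
    · simp only [hψ, sin_pi_div_two_sub]
      field_simp
    · simp only [hψ]
      rw [cos_pi_div_two_sub, ← tan_mul_cos hw.ne', tan_arctan]
      set w := cos (arctan (F μ))
      simp only [hF]
      field_simp
  have hiff : ∀ μ, 0 < μ → ((∃ v, P.IsRealPair μ v) ↔
      ∃ k : ℤ, P.prufer μ μ P.z2 - ψ μ = k * π) := fun μ hμ => by
    obtain ⟨m, hm, hs, hc⟩ := hdir μ hμ
    rw [exists_isRealPair_iff hμ.ne' h.c_zero h.d_zero, ← mul_assoc,
      Prufer.direction_eq_iff (right_ne_zero_of_mul hm.ne') hs hc]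
  have hΘ : ∀ μ, 0 < μ → 0 < P.prufer μ μ P.z2 := fun μ hμ =>
    prufer_pos hμ (right_mem_Ioc.2 P.hz)
  have hlev := Prufer.level_eq hlam (I := Ioi 0) ordConnected_Ioi
    (g := fun μ => P.prufer μ μ P.z2 - ψ μ) (m := 1) ?_ ?_ ?_ ?_ ?_ ?_ ?_ j
  · rw [add_comm 1 j] at hlev
    have hj : 0 < lam (j + 1) := hpos.trans_le (hlam.monotone (by omega))
    exact (heig (j + 1)).ncard_zeros hj h.c_zero h.d_zero
      (by linarith [hψ1 _ hj, pi_pos]) (by linarith [hψ2 (lam (j + 1))])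
  · have hc : ContinuousOn (fun s => P.prufer s s P.z2) (Ioi 0) :=
      P.continuousOn_prufer_right.comp (f := fun s : ℝ => (s, s)) (by fun_prop) fun s hs => hs
    refine hc.sub (continuousOn_const.sub (continuous_arctan.comp_continuousOn ?_))
    refine ContinuousOn.div (ContinuousOn.add (continuousOn_const.div continuousOn_id
      fun μ hμ => (ne_of_gt hμ)) continuousOn_const) (by fun_prop) fun μ hμ => (hY μ hμ).ne'
  · intro μ hμ μ' hμ' hle
    have h1 := h.monotoneOn_prufer_self hμ hμ' hle
    have h2 := arctan_mono (hFm hμ hμ' hle)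
    simp only [hψ] at h1 ⊢
    linarith
  · intro n
    constructor
    · intro hn
      by_contra! h1
      obtain rfl : n = 0 := by omega
      exact lt_asymm hneg hn
    · exact fun hn => hpos.trans_le (hlam.monotone hn)
  · exact fun n hn => (hiff _ (hpos.trans_le (hlam.monotone hn))).1 ⟨_, heig n⟩
  · intro μ hμ hk
    obtain ⟨v, hv⟩ := (hiff μ hμ).2 hk
    exact hall μ v hv
  · intro μ hμ
    linarith [hΘ μ hμ, hψ2 μ]
  · obtain ⟨δ, hδ, hδ'⟩ := h.exists_near_zero h0
    have hδ2 := half_pos hδ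
    obtain ⟨h1, h2⟩ := hδ' (δ / 2) (by rw [abs_of_pos hδ2]; exact half_lt_self hδ) (δ / 2) hδ2
    obtain ⟨m, hm, hs, hc⟩ := hdir (δ / 2) hδ2
    refine ⟨δ / 2, hδ2, ?_⟩
    by_contra! hgt
    have h3 := sin_nonneg_of_nonneg_of_le_pi hgt.le (by linarith [hψ1 _ hδ2, pi_pos])
    rw [sin_sub, hs, hc] at h3
    have h4 := mul_nonneg (sq_nonneg (P.b 1)) h3
    have h5 := mul_neg_of_pos_of_neg hm h2
    linarith

end IsLeftDefiniteRight
end SLP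

namespace SLP
open Real Set

variable {P : SLP} {l : ℝ} {v : ℝ → ℝ}

/-- The problem satisfied by `z ↦ φ (-z)` when `φ` solves `P`. -/
@[simps]
def reflect (P : SLP) : SLP where
  z1 := -P.z2
  z2 := -P.z1
  hz := neg_lt_neg P.hz
  p z := P.p (-z)
  q z := P.q (-z)
  r z := P.r (-z)
  a j := P.a j.rev
  b j := -P.b j.rev
  c j := P.c j.rev
  d j := -P.d j.rev
  hp := P.hp.comp contDiff_neg
  hr := P.hr.comp contDiff_neg
  hq := P.hq.comp continuous_neg
  hppos z hz := P.hppos _ ⟨le_neg.1 hz.2, neg_le.1 hz.1⟩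
  hrpos z hz := P.hrpos _ ⟨le_neg.1 hz.2, neg_le.1 hz.1⟩
  hab j := by simpa using P.hab j.rev

theorem reflect_reflect : P.reflect.reflect = P := by
  cases P
  simp [reflect]

theorem zb_reflect (j : Fin 2) : P.reflect.zb j = -P.zb j.rev := by
  fin_cases j <;> simp [zb]

theorem IsRealPair.reflect (h : P.IsRealPair l v) :
    P.reflect.IsRealPair l (fun z => v (-z)) where
  contDiff := h.contDiff.comp contDiff_neg
  exists_ne := by
    obtain ⟨z, hz, hv⟩ := h.exists_ne
    exact ⟨-z, ⟨neg_le_neg hz.2, neg_le_neg hz.1⟩, by simpa using hv⟩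
  hasDerivAt z hz := by
    have h1 := h.hasDerivAt (-z) ⟨lt_neg.1 hz.2, neg_lt.1 hz.1⟩
    have h2 := (h1.comp z (hasDerivAt_neg z)).neg
    convert! h2 using 1
    · ext w
      simp [deriv_comp_neg]
    · simp
  boundary j := by
    have h1 := h.boundary j.rev
    simp only [zb_reflect, deriv_comp_neg, neg_neg, reflect_p, reflect_a, reflect_b, reflect_c,
      reflect_d]
    linear_combination h1

theorem ncard_reflect (P : SLP) (f : ℝ → ℝ) :
    {z ∈ Ioo P.reflect.z1 P.reflect.z2 | f (-z) = 0}.ncard =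
      {z ∈ Ioo P.z1 P.z2 | f z = 0}.ncard := by
  rw [← ncard_image_of_injective {z ∈ Ioo P.z1 P.z2 | f z = 0} neg_injective]
  congr 1
  ext z
  simp only [reflect_z1, reflect_z2, image_neg_eq_neg, Set.mem_neg, mem_ofPred_eq, mem_Ioo,
    neg_lt, lt_neg, and_comm]

theorem isRealPair_re {φ : ℝ → ℂ} (hφ : ∀ z, (φ z).im = 0) (h : P.IsEigenpair (l : ℂ) φ) :
    P.IsRealPair l fun z => (φ z).re :=
  isEigenpair_ofReal_iff.1 (by
    rwa [show (fun z => (((φ z).re : ℝ) : ℂ)) = φ from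
      funext fun z => Complex.ext rfl (by simp [hφ])])

end SLP

namespace SLP
open Real Set

variable {P : SLP} {l : ℝ}

theorem isLeftDefiniteRight_of_inS (hS : ∀ j : Fin 2, P.inS j ↔ j = 1) (h : P.LeftDefinite)
    (hD : P.D 1 < 0) : P.IsLeftDefiniteRight := by
  obtain ⟨hq, h1, h2⟩ := h
  obtain ⟨hac, hbd, had⟩ := h1 1 ((hS 1).2 rfl)
  have h0 : P.c 0 = 0 ∧ P.d 0 = 0 := by simpa [inS] using hS 0
  have hleft := h2 0 (by simp [hS])
  replace hac := (div_nonpos_iff.1 hac).resolve_right fun H => hD.not_ge H.2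
  replace hbd := (div_nonpos_iff.1 hbd).resolve_right fun H => hD.not_ge H.2
  replace had := (div_nonneg_iff.1 had).resolve_left fun H => hD.not_ge H.2
  simp only [sgn, D, Fin.coe_ofNat_eq_mod] at hD had hleft
  norm_num at hD had hleft
  exact ⟨h0.1, h0.2, hq, hleft, hac.1, hbd.1, by simpa using had.1, hD⟩

theorem inS_reflect (j : Fin 2) : P.reflect.inS j ↔ P.inS j.rev := by
  simp [inS]

theorem D_reflect (j : Fin 2) : P.reflect.D j = P.D j.rev := by
  fin_cases j <;> simp [D, sgn] <;> ring

theorem LeftDefinite.reflect (h : P.LeftDefinite) : P.reflect.LeftDefinite := by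
  obtain ⟨hq, h1, h2⟩ := h
  refine ⟨fun z hz => hq _ ⟨le_neg.1 hz.2, neg_le.1 hz.1⟩, fun j hj => ?_, fun j hj => ?_⟩
  · obtain ⟨hac, hbd, had⟩ := h1 j.rev (inS_reflect j |>.1 hj)
    rw [D_reflect]
    refine ⟨hac, by simpa using hbd, had.trans_eq ?_⟩
    fin_cases j <;> simp [sgn]
  · refine (h2 j.rev (mt (inS_reflect j).2 hj)).imp (by simp) fun h3 => h3.trans_eq ?_
    fin_cases j <;> simp [sgn, div_neg, neg_div]

/-- A problem whose only eigenvalue-dependent boundary is `i` is equivalent to one where this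
boundary is the right one. -/
theorem exists_right (P : SLP) (i : Fin 2) (hS : ∀ j : Fin 2, P.inS j ↔ j = i) :
    ∃ Q : SLP, (∀ j : Fin 2, Q.inS j ↔ j = 1) ∧ Q.D 1 = P.D i ∧
      (Q.d 1 = 0 ↔ P.d i = 0) ∧ -Q.b 1 / Q.d 1 = -P.b i / P.d i ∧
      (P.LeftDefinite → Q.LeftDefinite) ∧
      (∀ l, (∃ v, Q.IsRealPair l v) → ∃ v, P.IsRealPair l v) ∧
      ∀ l v, P.IsRealPair l v → ∃ w, Q.IsRealPair l w ∧
        {z ∈ Ioo Q.z1 Q.z2 | w z = 0}.ncard = {z ∈ Ioo P.z1 P.z2 | v z = 0}.ncard := by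
  obtain rfl | rfl : i = 1 ∨ i = 0 := by omega
  · exact ⟨P, hS, rfl, Iff.rfl, rfl, id, fun _ => id, fun l v h => ⟨v, h, rfl⟩⟩
  · refine ⟨P.reflect, fun j => ?_, D_reflect 1, by simp, by simp [div_neg, neg_div],
      LeftDefinite.reflect, ?_, fun l v h => ⟨_, h.reflect, P.ncard_reflect v⟩⟩
    · rw [inS_reflect, hS]
      fin_cases j <;> simp
    · rintro l ⟨v, hv⟩
      have := hv.reflect
      rw [reflect_reflect] at this
      exact ⟨_, this⟩

end SLP

/-- **oscillation counts.** Suppose exactly one boundary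
condition is λ-dependent, `S = {i}`, and the eigenvalues are listed as a
strictly increasing sequence `λ_n → +∞` with real-valued eigen-solutions
`φ_n`. Then: (i) if the problem is right-definite and `d_i ≠ 0`, `φ_n` has
`n` zeros in `(z₁,z₂)` when `λ_n < −b_i/d_i` and `n−1` zeros when
`λ_n ≥ −b_i/d_i`; (ii) if right-definite and `d_i = 0`, `φ_n` has `n` zeros;
(iii) if left-definite with `D_i < 0` and `0` not an eigenvalue, then
`λ₀ < 0 < λ₁`, both `φ₀` and `φ₁` have no zeros in `(z₁,z₂)`, and `φ_n` has
`n−1` zeros for `n > 1`. -/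
theorem statement_4 (P : SLP) (i : Fin 2) (hS : ∀ j : Fin 2, P.inS j ↔ j = i)
    (lam : ℕ → ℝ) (φ : ℕ → ℝ → ℂ)
    (hmono : StrictMono lam)
    (htop : Tendsto lam atTop atTop)
    (heig : ∀ n : ℕ, P.IsEigenpair (lam n) (φ n))
    (hreal : ∀ (n : ℕ) (z : ℝ), (φ n z).im = 0)
    (hall : ∀ μc : ℂ, P.IsEigenvalue μc → ∃ n : ℕ, μc = (lam n : ℂ)) :
    ((P.RightDefinite ∧ P.d i ≠ 0) → ∀ n : ℕ,
      (lam n < -P.b i / P.d i →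
        Set.ncard {z ∈ Set.Ioo P.z1 P.z2 | φ n z = 0} = n) ∧
      (-P.b i / P.d i ≤ lam n →
        Set.ncard {z ∈ Set.Ioo P.z1 P.z2 | φ n z = 0} = n - 1)) ∧
    ((P.RightDefinite ∧ P.d i = 0) → ∀ n : ℕ,
      Set.ncard {z ∈ Set.Ioo P.z1 P.z2 | φ n z = 0} = n) ∧
    ((P.LeftDefinite ∧ P.D i < 0 ∧ ¬ P.IsEigenvalue 0) →
      lam 0 < 0 ∧ 0 < lam 1 ∧
      Set.ncard {z ∈ Set.Ioo P.z1 P.z2 | φ 0 z = 0} = 0 ∧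
      Set.ncard {z ∈ Set.Ioo P.z1 P.z2 | φ 1 z = 0} = 0 ∧
      ∀ n : ℕ, 1 < n →
        Set.ncard {z ∈ Set.Ioo P.z1 P.z2 | φ n z = 0} = n - 1) := by
  obtain ⟨Q, hQS, hQD, hQd, hQb, hQL, hQP, hPQ⟩ := P.exists_right i hS
  have hzero : ∀ n, {z ∈ Set.Ioo P.z1 P.z2 | φ n z = 0} =
      {z ∈ Set.Ioo P.z1 P.z2 | (φ n z).re = 0} := fun n =>
    Set.ext fun z => and_congr_right fun _ => by simp [Complex.ext_iff, hreal]
  choose w hw hcard using fun n => hPQ _ _ (SLP.isRealPair_re (hreal n) (heig n))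
  simp only [hzero, ← hcard]
  have hallQ : ∀ μ v, Q.IsRealPair μ v → ∃ n, μ = lam n := fun μ v hv => by
    obtain ⟨v', hv'⟩ := hQP μ ⟨v, hv⟩
    obtain ⟨n, hn⟩ := hall μ ⟨_, SLP.isEigenpair_ofReal_iff.2 hv'⟩
    exact ⟨n, by exact_mod_cast hn⟩
  obtain ⟨hc, hd⟩ : Q.c 0 = 0 ∧ Q.d 0 = 0 := by simpa [SLP.inS] using hQS 0
  have hright : P.RightDefinite → 0 < Q.b 1 * Q.c 1 - Q.a 1 * Q.d 1 := fun h => by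
    have h1 := h i ((hS i).2 rfl)
    rw [← hQD] at h1
    simp only [SLP.D, SLP.sgn, Fin.coe_ofNat_eq_mod] at h1
    norm_num at h1
    linarith
  refine ⟨fun ⟨h, hdi⟩ n => ?_, fun ⟨h, hdi⟩ n => ?_, fun ⟨h, hDi, h0⟩ => ?_⟩
  · rw [← hQb]
    exact (SLP.ncard_zeros_of_rightDefinite hc hd hmono hw hallQ (hright h) n).1
      (mt hQd.1 hdi)
  · exact (SLP.ncard_zeros_of_rightDefinite hc hd hmono hw hallQ (hright h) n).2 (hQd.2 hdi)
  · have hL := SLP.isLeftDefiniteRight_of_inS hQS (hQL h) (hQD ▸ hDi)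
    have h0Q : ¬ ∃ v, Q.IsRealPair 0 v := fun hv => by
      obtain ⟨v, hv⟩ := hQP 0 hv
      exact h0 ⟨_, by simpa using SLP.isEigenpair_ofReal_iff.2 hv⟩
    refine ⟨(hL.neg_and_pos h0Q hmono hw hallQ).1, (hL.neg_and_pos h0Q hmono hw hallQ).2,
      hL.ncard_zeros_zero h0Q hmono hw hallQ, hL.ncard_zeros_succ h0Q hmono hw hallQ 0,
      fun n hn => ?_⟩
    obtain ⟨j, rfl⟩ : ∃ j, n = j + 1 := ⟨n - 1, by omega⟩
    exact hL.ncard_zeros_succ h0Q hmono hw hallQ j
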